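/- arXiv:math/0301293 — 3 statements merged into one kernel-verified Lean document; each statement's English description precedes it below -/
import Mathlib

section
/- Let f : X → Y be a σ-perfect n-dimensional map between metrizable spaces, where Y is a C-space. Then for every integer k with 0 ≤ k ≤ n, the space C*(X, ℝ^k) with the source limitation topology contains a dense G_δ-subset of maps g such that the map f×g : X → Y × ℝ^k is (n − k)-dimensional. -/
open Set Topology Metric BoundedContinuousFunction

noncomputable section

/-- Covering dimension at most `n` (for a natural number `n`): every finite open cover
has an open refinement covering the space such that every point belongs to at most
`n + 1` members of the refinement. -/
def CovDimLENat (X : Type*) [TopologicalSpace X] (n : ℕ) : Prop :=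
  ∀ 𝒰 : Set (Set X), 𝒰.Finite → (∀ U ∈ 𝒰, IsOpen U) → ⋃₀ 𝒰 = Set.univ →
    ∃ 𝒱 : Set (Set X), (∀ V ∈ 𝒱, IsOpen V) ∧ ⋃₀ 𝒱 = Set.univ ∧
      (∀ V ∈ 𝒱, ∃ U ∈ 𝒰, V ⊆ U) ∧
      ∀ x : X, {V ∈ 𝒱 | x ∈ V}.Finite ∧ {V ∈ 𝒱 | x ∈ V}.ncard ≤ n + 1

/-- Covering dimension at most `n` for an integer `n`; negative bounds mean the space
is empty (`dim ∅ = -1`). -/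
def CovDimLE (X : Type*) [TopologicalSpace X] (n : ℤ) : Prop :=
  IsEmpty X ∨ ∃ k : ℕ, (k : ℤ) ≤ n ∧ CovDimLENat X k

/-- A space is finite-dimensional if its covering dimension is at most `n` for some `n`. -/
def FiniteDimSpace (X : Type*) [TopologicalSpace X] : Prop :=
  ∃ n : ℕ, CovDimLENat X n

/-- A perfect map: continuous, closed, with compact fibers. -/
def IsPerfectMap {X Y : Type*} [TopologicalSpace X] [TopologicalSpace Y] (f : X → Y) : Prop :=
  Continuous f ∧ IsClosedMap f ∧ ∀ y : Y, IsCompact (f ⁻¹' {y})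

/-- A σ-perfect map: `X` is a countable union of closed sets `A i` whose images are
closed and on which `f` restricts to a perfect map onto its image. -/
def IsSigmaPerfectMap {X Y : Type*} [TopologicalSpace X] [TopologicalSpace Y] (f : X → Y) :
    Prop :=
  Continuous f ∧ ∃ A : ℕ → Set X, (⋃ i, A i) = Set.univ ∧
    ∀ i, IsClosed (A i) ∧ IsClosed (f '' A i) ∧
      IsPerfectMap (Set.MapsTo.restrict f (A i) (f '' A i) (Set.mapsTo_image f (A i)))

/-- `dim f ≤ k`: every fiber of `f` has covering dimension at most `k`. -/
def DimMapLE {X Y : Type*} [TopologicalSpace X] [TopologicalSpace Y] (f : X → Y) (k : ℤ) :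
    Prop :=
  ∀ y : Y, CovDimLE (f ⁻¹' {y}) k

/-- `B_n(h)`: the set of points of the codomain having at least `n` preimages. -/
def BranchSet {X Z : Type*} (h : X → Z) (n : ℕ) : Set Z :=
  {z | ∃ S : Finset X, n ≤ S.card ∧ ∀ x ∈ S, h x = z}

/-- The source limitation topology on the space of bounded continuous maps. -/
def sourceLimitation (X E : Type*) [TopologicalSpace X] [PseudoMetricSpace E] :
    TopologicalSpace (X →ᵇ E) where
  IsOpen U := ∀ g ∈ U, ∃ α : X → ℝ, Continuous α ∧ (∀ x, 0 < α x) ∧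
    ∀ h : X →ᵇ E, (∀ x, dist (h x) (g x) ≤ α x) → h ∈ U
  isOpen_univ := fun g _ =>
    ⟨fun _ => 1, continuous_const, fun _ => one_pos, fun _ _ => trivial⟩
  isOpen_inter := by
    rintro U V hU hV g ⟨hgU, hgV⟩
    obtain ⟨α, hαc, hαp, hα⟩ := hU g hgU
    obtain ⟨β, hβc, hβp, hβ⟩ := hV g hgV
    exact ⟨fun x => min (α x) (β x), hαc.min hβc, fun x => lt_min (hαp x) (hβp x),
      fun h hh => ⟨hα h fun x => (hh x).trans (min_le_left _ _),
        hβ h fun x => (hh x).trans (min_le_right _ _)⟩⟩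
  isOpen_sUnion := by
    rintro S hS g ⟨U, hU, hgU⟩
    obtain ⟨α, hc, hp, h⟩ := hS U hU g hgU
    exact ⟨α, hc, hp, fun h' hh' => ⟨U, hU, h h' hh'⟩⟩

/-- A C-space. -/
def IsCSpace (Y : Type*) [TopologicalSpace Y] : Prop :=
  ∀ 𝒰 : ℕ → Set (Set Y), (∀ n, (∀ U ∈ 𝒰 n, IsOpen U) ∧ ⋃₀ 𝒰 n = Set.univ) →
    ∃ 𝒱 : ℕ → Set (Set Y),
      (∀ n, (∀ V ∈ 𝒱 n, IsOpen V) ∧ (∀ V ∈ 𝒱 n, ∃ U ∈ 𝒰 n, V ⊆ U) ∧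
        (𝒱 n).Pairwise (Disjoint · ·)) ∧
      ⋃₀ (⋃ n, 𝒱 n) = Set.univ

/-- `F` is a `Z_m`-set in `M`: `F` is closed and the maps from the `m`-cube avoiding `F`
are dense in `C(𝕀^m, M)` (uniform convergence topology). -/
def IsZmSet (m : ℕ) {M : Type*} [TopologicalSpace M] (F : Set M) : Prop :=
  IsClosed F ∧ Dense {u : C((Fin m → unitInterval), M) | ∀ z, u z ∉ F}

/-- `F` is a `Z`-set in `M` if it is a `Z_m`-set for all `m`. -/
def IsZSet {M : Type*} [TopologicalSpace M] (F : Set M) : Prop :=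
  ∀ m : ℕ, IsZmSet m F

end

lemma covDim_indexed {T : Type*} [TopologicalSpace T] {n : ℕ} (h : CovDimLENat T n)
    {ι : Type*} [Finite ι] (U : ι → Set T) (hU : ∀ i, IsOpen (U i)) (hc : ⋃ i, U i = univ) :
    ∃ G : ι → Set T, (∀ i, IsOpen (G i)) ∧ (∀ i, G i ⊆ U i) ∧ (⋃ i, G i = univ) ∧
      ∀ x, {i | x ∈ G i}.ncard ≤ n + 1 := by
  classical
  obtain ⟨𝒱, hVo, hVc, hVr, hVn⟩ := h (range U) (finite_range U)
    (by rintro _ ⟨i, rfl⟩; exact hU i) (by rw [sUnion_range, hc])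
  have hVr' : ∀ V ∈ 𝒱, ∃ i, V ⊆ U i := by
    intro V hV
    obtain ⟨_, ⟨i, rfl⟩, hi⟩ := hVr V hV
    exact ⟨i, hi⟩
  by_cases hι : Nonempty ι
  swap
  · have : IsEmpty T := by
      rw [not_nonempty_iff] at hι
      rw [iUnion_of_empty] at hc
      exact univ_eq_empty_iff.mp hc.symm
    exact ⟨U, hU, fun i => Subset.rfl, hc, fun x => (this.false x).elim⟩
  choose! idx hidx using hVr'
  refine ⟨fun i => ⋃₀ {V ∈ 𝒱 | idx V = i}, fun i => isOpen_sUnion fun V hV => hVo V hV.1,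
    fun i => sUnion_subset fun V hV => hV.2 ▸ hidx V hV.1, ?_, fun x => ?_⟩
  · refine eq_univ_of_forall fun x => ?_
    have : x ∈ ⋃₀ 𝒱 := hVc ▸ mem_univ x
    obtain ⟨V, hV, hx⟩ := this
    exact mem_iUnion.2 ⟨idx V, V, ⟨hV, rfl⟩, hx⟩
  · have hsub : {i | x ∈ ⋃₀ {V ∈ 𝒱 | idx V = i}} ⊆ idx '' {V ∈ 𝒱 | x ∈ V} := by
      rintro i ⟨V, ⟨hV, rfl⟩, hx⟩
      exact ⟨V, ⟨hV, hx⟩, rfl⟩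
    calc _ ≤ (idx '' {V ∈ 𝒱 | x ∈ V}).ncard := ncard_le_ncard hsub ((hVn x).1.image _)
      _ ≤ _ := ncard_image_le (hVn x).1
      _ ≤ _ := (hVn x).2

lemma exists_near_avoid {V : Type*} [NormedAddCommGroup V] [NormedSpace ℝ V]
    [FiniteDimensional ℝ V] (M : Set (Submodule ℝ V)) (hM : M.Finite) (hM' : ∀ m ∈ M, m ≠ ⊤)
    (v : V) {δ : ℝ} (hδ : 0 < δ) : ∃ v', ‖v' - v‖ < δ ∧ ∀ m ∈ M, v' ∉ m := by
  letI : MeasurableSpace V := borel V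
  haveI : BorelSpace V := ⟨rfl⟩
  let μ : MeasureTheory.Measure V := MeasureTheory.Measure.addHaar
  have h0 : μ (⋃ m ∈ M, (m : Set V)) = 0 :=
    (MeasureTheory.measure_biUnion_null_iff hM.countable).2 fun m hm =>
      MeasureTheory.Measure.addHaar_submodule μ m (hM' m hm)
  have h1 : 0 < μ (ball v δ) := measure_ball_pos μ v hδ
  by_contra! hcon
  have : ball v δ ⊆ ⋃ m ∈ M, (m : Set V) := by
    intro v' hv'
    obtain ⟨m, hm, hv⟩ := hcon v' (by simpa [dist_eq_norm] using hv')
    exact mem_biUnion hm hv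
  exact absurd (MeasureTheory.measure_mono_null this h0) h1.ne'

lemma general_position {V : Type*} [NormedAddCommGroup V] [NormedSpace ℝ V]
    [FiniteDimensional ℝ V] {n : ℕ} (hV : n < Module.finrank ℝ V) {ι : Type*} [Fintype ι]
    (v : ι → V) {δ : ℝ} (hδ : 0 < δ) :
    ∃ v' : ι → V, (∀ i, ‖v' i - v i‖ < δ) ∧
      ∀ w : ι → ℝ, {i | w i ≠ 0}.ncard ≤ n + 1 → w ≠ 0 → ∑ i, w i • v' i ≠ 0 := by
  classical
  have key : ∀ s : Finset ι, ∃ v' : ι → V, (∀ i, ‖v' i - v i‖ < δ) ∧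
      ∀ w : ι → ℝ, (∀ i, w i ≠ 0 → i ∈ s) → {i | w i ≠ 0}.ncard ≤ n + 1 → w ≠ 0 →
        ∑ i, w i • v' i ≠ 0 := by
    intro s
    induction s using Finset.induction_on with
    | empty =>
      refine ⟨v, fun i => by simpa using hδ, fun w hw _ hw0 => ?_⟩
      exact absurd (funext fun i => by by_contra h; simpa using hw i h) hw0
    | insert a s ha ih =>
      obtain ⟨v', hv', hgp⟩ := ih
      let M : Set (Submodule ℝ V) :=
        (fun t : Finset ι => Submodule.span ℝ (v' '' t)) '' {t | t.card ≤ n}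
      have hM : M.Finite := (toFinite _).image _
      have hM' : ∀ m ∈ M, m ≠ ⊤ := by
        rintro _ ⟨t, ht, rfl⟩ htop
        have h1 : Module.finrank ℝ (Submodule.span ℝ (v' '' (t : Set ι))) ≤ n := by
          rw [← Finset.coe_image]
          exact (finrank_span_finset_le_card _).trans (Finset.card_image_le.trans ht)
        simp only [] at htop
        rw [htop, finrank_top] at h1
        omega
      obtain ⟨u, hu, huM⟩ := exists_near_avoid M hM hM' (v a) hδ
      refine ⟨Function.update v' a u, fun i => ?_, fun w hws hwc hw0 hsum => ?_⟩
      · by_cases h : i = a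
        · subst h; simpa using hu
        · simpa [h] using hv' i
      by_cases hwa : w a = 0
      · refine hgp w (fun i hi => ?_) hwc hw0 ?_
        · rcases Finset.mem_insert.1 (hws i hi) with h | h
          · subst h; exact absurd hwa hi
          · exact h
        · rw [← hsum]
          refine Finset.sum_congr rfl fun i _ => ?_
          by_cases h : i = a
          · subst h; simp [hwa]
          · simp [h]
      · let t : Finset ι := Finset.univ.filter fun i => i ≠ a ∧ w i ≠ 0
        have ht : t.card ≤ n := by
          have h1 : {i | w i ≠ 0}.ncard = (insert a t).card := by
            rw [← ncard_coe_finset]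
            congr 1
            ext i
            by_cases h : i = a
            · subst h; simp [hwa]
            · simp [t, h]
          rw [h1, Finset.card_insert_of_notMem (by simp [t])] at hwc
          omega
        apply huM _ ⟨t, ht, rfl⟩
        have h2 : w a • u + ∑ i ∈ t, w i • v' i = 0 := by
          rw [← hsum, ← Finset.add_sum_erase _ _ (Finset.mem_univ a)]
          congr 1
          · simp
          · refine (Finset.sum_congr rfl fun i hi => ?_).trans
              (Finset.sum_subset (s₁ := t) ?_ ?_)
            · have : i ≠ a := by simp [t] at hi; exact hi.1
              simp only [Function.update_of_ne this]
            · intro i hi; simp [t] at hi; simp [hi.1]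
            · intro i hi hi'
              simp at hi
              have : w i = 0 := by by_contra h; exact hi' (by simp [t, hi, h])
              simp [this]
        have h3 : u = -(w a)⁻¹ • ∑ i ∈ t, w i • v' i := by
          have : w a • u = - ∑ i ∈ t, w i • v' i := eq_neg_of_add_eq_zero_left h2
          rw [neg_smul, ← smul_neg, ← this, smul_smul, inv_mul_cancel₀ hwa, one_smul]
        rw [h3]
        refine Submodule.smul_mem _ _ (Submodule.sum_mem _ fun i hi => Submodule.smul_mem _ _ ?_)
        exact Submodule.subset_span ⟨i, hi, rfl⟩
  obtain ⟨v', h1, h2⟩ := key Finset.univ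
  exact ⟨v', h1, fun w hc h0 => h2 w (fun _ _ => Finset.mem_univ _) hc h0⟩

lemma avoid_zero {T : Type*} [TopologicalSpace T] [NormalSpace T] [T2Space T] {n : ℕ}
    (h : CovDimLENat T n)
    {V : Type*} [NormedAddCommGroup V] [NormedSpace ℝ V]
    [FiniteDimensional ℝ V] (hV : n < Module.finrank ℝ V) {K : Set T} (hK : IsCompact K)
    (Φ : C(T, V)) {δ : ℝ} (hδ : 0 < δ) :
    ∃ Φ' : C(T, V), (∀ x ∈ K, ‖Φ' x - Φ x‖ < δ) ∧ ∀ x ∈ K, Φ' x ≠ 0 := by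
  classical
  have hΦK : IsCompact (Φ '' K) := hK.image Φ.continuous
  obtain ⟨t, -, htc⟩ := hΦK.elim_nhds_subcover (fun v => ball v (δ / 2))
    (fun v _ => ball_mem_nhds v (half_pos hδ))
  let U : Option t → Set T := fun o => o.elim Kᶜ fun v => Φ ⁻¹' ball (v : V) (δ / 2)
  obtain ⟨G, hGo, hGU, hGc, hGn⟩ := covDim_indexed h U
    (by
      rintro (_ | v)
      · exact hK.isClosed.isOpen_compl
      · exact isOpen_ball.preimage Φ.continuous)
    (by
      refine eq_univ_of_forall fun x => ?_
      by_cases hx : x ∈ K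
      · obtain ⟨v, hv, hx'⟩ := mem_iUnion₂.1 (htc (mem_image_of_mem Φ hx))
        exact mem_iUnion.2 ⟨some ⟨v, hv⟩, hx'⟩
      · exact mem_iUnion.2 ⟨none, hx⟩)
  obtain ⟨v', hv', hgp⟩ := general_position hV (fun v : t => (v : V)) (half_pos hδ)
  obtain ⟨ρ, hρ⟩ := PartitionOfUnity.exists_isSubordinate_of_locallyFinite hK.isClosed
    (fun v : t => G (some v)) (fun v => hGo _) (locallyFinite_of_finite _) (by
      intro x hx
      have : x ∈ ⋃ i, G i := hGc ▸ mem_univ x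
      obtain ⟨o, ho⟩ := mem_iUnion.1 this
      rcases o with _ | v
      · exact absurd hx (hGU _ ho)
      · exact mem_iUnion.2 ⟨v, ho⟩)
  have hsum : ∀ x ∈ K, ∑ v, ρ v x = 1 := fun x hx => by
    rw [← finsum_eq_sum_of_fintype]; exact ρ.sum_eq_one hx
  have hmem : ∀ v x, ρ v x ≠ 0 → x ∈ G (some v) := fun v x hx =>
    hρ v (subset_tsupport _ hx)
  refine ⟨⟨fun x => ∑ v, ρ v x • v' v, by fun_prop⟩, fun x hx => ?_, fun x hx => ?_⟩
  · have h1 : (∑ v, ρ v x • v' v) - Φ x = ∑ v, ρ v x • (v' v - Φ x) := by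
      simp_rw [smul_sub, Finset.sum_sub_distrib, ← Finset.sum_smul, hsum x hx, one_smul]
    change ‖(∑ v, ρ v x • v' v) - Φ x‖ < δ
    rw [h1]
    have h2 : ∀ v ∈ Finset.univ, ‖ρ v x • (v' v - Φ x)‖ ≤ ρ v x * ‖v' v - Φ x‖ := fun v _ => by
      rw [norm_smul, Real.norm_of_nonneg (ρ.nonneg v x)]
    obtain ⟨v0, -, hv0⟩ : ∃ v0 ∈ Finset.univ, ρ v0 x ≠ 0 := by
      by_contra! hcon
      have := hsum x hx
      rw [Finset.sum_eq_zero hcon] at this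
      exact zero_ne_one this
    have hlt : ∀ v, ρ v x ≠ 0 → ‖v' v - Φ x‖ < δ := fun v hv => by
      have h3 : ‖Φ x - v‖ < δ / 2 := by
        have := hGU _ (hmem v x hv)
        simpa [U, dist_eq_norm] using this
      calc ‖v' v - Φ x‖ = ‖(v' v - v) - (Φ x - v)‖ := by congr 1; abel
        _ ≤ ‖v' v - v‖ + ‖Φ x - v‖ := norm_sub_le _ _
        _ < δ := by have := hv' v; linarith
    calc ‖∑ v, ρ v x • (v' v - Φ x)‖ ≤ ∑ v, ρ v x * ‖v' v - Φ x‖ := norm_sum_le_of_le _ h2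
      _ < ∑ v, ρ v x * δ := by
        refine Finset.sum_lt_sum (fun v _ => ?_) ⟨v0, Finset.mem_univ _, ?_⟩
        · by_cases hv : ρ v x = 0
          · simp [hv]
          · exact mul_le_mul_of_nonneg_left (hlt v hv).le (ρ.nonneg v x)
        · exact mul_lt_mul_of_pos_left (hlt v0 hv0) (lt_of_le_of_ne (ρ.nonneg v0 x) hv0.symm)
      _ = δ := by rw [← Finset.sum_mul, hsum x hx, one_mul]
  · refine hgp (fun v => ρ v x) ?_ ?_
    · have hsub : some '' {v : t | ρ v x ≠ 0} ⊆ {o | x ∈ G o} := by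
        rintro _ ⟨v, hv, rfl⟩; exact hmem v x hv
      have := ncard_le_ncard hsub (toFinite _)
      rw [ncard_image_of_injective _ (Option.some_injective _)] at this
      exact this.trans (hGn x)
    · intro h0
      have := hsum x hx
      rw [Finset.sum_eq_zero fun v _ => congrFun h0 v] at this
      exact zero_ne_one this

lemma avoid_finite {T : Type*} [TopologicalSpace T] [NormalSpace T] [T2Space T] {n : ℕ}
    (h : CovDimLENat T n)
    {V : Type*} [NormedAddCommGroup V] [NormedSpace ℝ V]
    [FiniteDimensional ℝ V] (hV : n < Module.finrank ℝ V) {K : Set T} (hK : IsCompact K)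
    {ι : Type*} (s : Finset ι) (t : ι → C(T, V)) (F : C(T, V)) {δ : ℝ} (hδ : 0 < δ) :
    ∃ F' : C(T, V), (∀ x ∈ K, ‖F' x - F x‖ < δ) ∧ ∀ i ∈ s, ∀ x ∈ K, F' x ≠ t i x := by
  classical
  induction s using Finset.induction_on generalizing F δ with
  | empty => exact ⟨F, fun x _ => by simpa using hδ, by simp⟩
  | insert a s ha ih =>
    obtain ⟨F1, hF1, hF1'⟩ := ih F (half_pos hδ)
    have hpos : ∃ r > 0, ∀ i ∈ s, ∀ x ∈ K, r ≤ ‖F1 x - t i x‖ := by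
      have : ∀ i ∈ s, ∃ r > 0, ∀ x ∈ K, r ≤ ‖F1 x - t i x‖ := by
        intro i hi
        rcases K.eq_empty_or_nonempty with rfl | hne
        · exact ⟨1, one_pos, by simp⟩
        obtain ⟨x0, hx0, hmin⟩ := hK.exists_isMinOn hne
          (f := fun x => ‖F1 x - t i x‖) (by fun_prop)
        exact ⟨_, norm_pos_iff.2 (sub_ne_zero.2 (hF1' i hi x0 hx0)), fun x hx => hmin hx⟩
      choose! r hr hr' using this
      rcases s.eq_empty_or_nonempty with rfl | hne
      · exact ⟨1, one_pos, by simp⟩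
      obtain ⟨i0, hi0, hm⟩ := s.exists_min_image r hne
      exact ⟨r i0, hr i0 hi0, fun i hi x hx => (hm i hi).trans (hr' i hi x hx)⟩
    obtain ⟨r, hr, hr'⟩ := hpos
    obtain ⟨Φ', h1, h2⟩ := avoid_zero h hV hK (F1 - t a) (lt_min (half_pos hδ) hr)
    refine ⟨Φ' + t a, fun x hx => ?_, fun i hi x hx heq => ?_⟩
    · have e1 := (h1 x hx).trans_le (min_le_left _ _)
      have e2 := hF1 x hx
      calc ‖(Φ' + t a) x - F x‖ = ‖(Φ' x - (F1 - t a) x) + (F1 x - F x)‖ := by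
            congr 1; simp only [ContinuousMap.add_apply, ContinuousMap.sub_apply]; abel
        _ ≤ _ := norm_add_le _ _
        _ < δ := by linarith
    · rcases Finset.mem_insert.1 hi with rfl | hi
      · exact h2 x hx (by simpa using heq)
      · have e1 := (h1 x hx).trans_le (min_le_right _ _)
        have e2 := hr' i hi x hx
        have : ‖Φ' x - (F1 - t a) x‖ = ‖F1 x - t i x‖ := by
          rw [← heq, ← norm_neg]
          congr 1; simp only [ContinuousMap.add_apply, ContinuousMap.sub_apply]; abel
        linarith

/-- Avoidance, with functions on an ambient normal space. -/
lemma avoid_ambient {X : Type*} [TopologicalSpace X] [TopologicalSpace.MetrizableSpace X] {n : ℕ}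
    {T K : Set X} (hKT : K ⊆ T) (hK : IsCompact K) (h : CovDimLENat T n)
    {V : Type*} [NormedAddCommGroup V] [NormedSpace ℝ V]
    [FiniteDimensional ℝ V] (hV : n < Module.finrank ℝ V)
    {ι : Type*} (s : Finset ι) (t : ι → C(X, V)) (F : C(X, V)) {δ : ℝ} (hδ : 0 < δ) :
    ∃ F' : C(X, V), (∀ x, ‖F' x - F x‖ ≤ δ) ∧ ∀ i ∈ s, ∀ x ∈ K, F' x ≠ t i x := by
  have hK' : IsCompact ((↑) ⁻¹' K : Set T) := by
    rw [Subtype.isCompact_iff]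
    simpa [Subtype.image_preimage_coe, inter_eq_self_of_subset_right hKT] using hK
  obtain ⟨F1, h1, h2⟩ := avoid_finite h hV hK' s (fun i => (t i).restrict T) (F.restrict T) hδ
  let D : K →ᵇ V := BoundedContinuousFunction.ofNormedAddCommGroup
    (fun x : K => F1 ⟨x, hKT x.2⟩ - F x) (by fun_prop) δ
    (fun x => (h1 ⟨x, hKT x.2⟩ x.2).le)
  have hD : ‖D‖ ≤ δ := (BoundedContinuousFunction.norm_le hδ.le).2
    fun x => (h1 ⟨x, hKT x.2⟩ x.2).le
  obtain ⟨D', hn, hr⟩ := BoundedContinuousFunction.exists_norm_eq_domRestrict_eq hK.isClosed ℝ D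
  refine ⟨F + D'.toContinuousMap, fun x => ?_, fun i hi x hx heq => ?_⟩
  · have := D'.norm_coe_le_norm x
    simp only [ContinuousMap.add_apply, add_sub_cancel_left]
    exact this.trans (hn.le.trans hD)
  · have e : D' x = F1 ⟨x, hKT hx⟩ - F x := by
      have := DFunLike.congr_fun hr ⟨x, hx⟩
      exact this
    apply h2 i hi ⟨x, hKT hx⟩ hx
    have : F x + D' x = t i x := heq
    rw [e] at this
    simpa using this

lemma finite_pos_le {ι : Type*} [Finite ι] (r : ι → ℝ) (hr : ∀ i, 0 < r i) :
    ∃ ρ > 0, ∀ i, ρ ≤ r i := by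
  rcases isEmpty_or_nonempty ι with h | h
  · exact ⟨1, one_pos, fun i => h.elim i⟩
  · obtain ⟨i, hi⟩ := Finite.exists_min r
    exact ⟨r i, hr i, hi⟩

lemma proper_image_closed {X Y : Type*} [TopologicalSpace X] [TopologicalSpace Y] {f : X → Y}
    {A : Set X} (hp : IsProperMap (fun a : A => f a)) {C : Set X} (hC : IsClosed C)
    (hCA : C ⊆ A) : IsClosed (f '' C) := by
  have := hp.isClosedMap _ (hC.preimage (continuous_subtype_val (p := (· ∈ A))))
  convert this using 1
  ext y
  constructor
  · rintro ⟨x, hx, rfl⟩; exact ⟨⟨x, hCA hx⟩, hx, rfl⟩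
  · rintro ⟨x, hx, rfl⟩; exact ⟨x, hx, rfl⟩

lemma proper_fiber_compact {X Y : Type*} [TopologicalSpace X] [TopologicalSpace Y] {f : X → Y}
    {A : Set X} (hp : IsProperMap (fun a : A => f a)) (y : Y) : IsCompact (A ∩ f ⁻¹' {y}) := by
  have := (isProperMap_iff_isClosedMap_and_compact_fibers.1 hp).2.2 y
  have := this.image continuous_subtype_val
  convert this using 1
  ext x
  simp [and_comm]

lemma local_step {X Y : Type*} [TopologicalSpace X] [TopologicalSpace.MetrizableSpace X]
    [TopologicalSpace Y] {n : ℕ} {E1 E2 : Type*}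
    [NormedAddCommGroup E1] [NormedSpace ℝ E1] [FiniteDimensional ℝ E1] [Nontrivial E1]
    [NormedAddCommGroup E2] [NormedSpace ℝ E2] [FiniteDimensional ℝ E2]
    (hdim : n < Module.finrank ℝ E1 + Module.finrank ℝ E2)
    {f : X → Y} {A : Set X} (hA : IsClosed A) (hp : IsProperMap (fun a : A => f a)) (y : Y)
    (hd : CovDimLENat (f ⁻¹' {y}) n) (φ : C(X, E1)) {ε : ℝ} (hε : 0 < ε)
    {S : Set (X →ᵇ E2)} (hS : IsCompact S) {η : ℝ} (hη : 0 < η) :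
    ∃ d : X →ᵇ E2, (∀ x, ‖d x‖ ≤ 3 * η) ∧ ∃ U : Set Y, IsOpen U ∧ y ∈ U ∧
      ∀ s ∈ S, ∃ ψ : C(X, E1), (∀ x, ‖ψ x - φ x‖ ≤ ε) ∧
        ∀ x ∈ A, f x ∈ U → ‖s x + d x‖ ≤ η / 2 → ψ x ≠ 0 := by
  classical
  obtain ⟨F, -, hF⟩ := hS.elim_nhds_subcover (fun s => ball s (η / 2))
    (fun s _ => ball_mem_nhds s (half_pos hη))
  -- distinct small vectors
  have hinf : (ball (0 : E1) (ε / 2)).Infinite :=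
    infinite_of_mem_nhds (0 : E1) (ball_mem_nhds _ (half_pos hε))
  let c : F → E1 := fun a => hinf.natEmbedding _ (F.equivFin a)
  have hc : Function.Injective c := by
    intro a b hab
    have h1 := (hinf.natEmbedding _).injective (Subtype.ext hab)
    exact F.equivFin.injective (Fin.ext h1)
  have hcn : ∀ a, ‖c a‖ ≤ ε / 2 := fun a => by
    have := (hinf.natEmbedding _ (F.equivFin a)).2
    rw [mem_ball_zero_iff] at this
    exact this.le
  obtain ⟨κ, hκ, hκ'⟩ := finite_pos_le (fun p : {p : F × F // p.1 ≠ p.2} => ‖c p.1.1 - c p.1.2‖)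
    (fun p => norm_pos_iff.2 (sub_ne_zero.2 (hc.ne p.2)))
  have hK := proper_fiber_compact hp y
  obtain ⟨F', hF1, hF2⟩ := avoid_ambient (V := E1 × E2) (K := A ∩ f ⁻¹' {y}) inter_subset_right hK
    hd (by simpa using hdim) (Finset.univ : Finset F)
    (fun a => (ContinuousMap.const X (c a)).prodMk (-(a : X →ᵇ E2).toContinuousMap))
    (φ.prodMk 0) (lt_min (half_pos hε) hη)
  let ψ0 : C(X, E1) := ⟨fun x => (F' x).1, by fun_prop⟩
  let e : C(X, E2) := ⟨fun x => (F' x).2, by fun_prop⟩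
  have hψ0 : ∀ x, ‖ψ0 x - φ x‖ ≤ ε / 2 := fun x =>
    (norm_fst_le (F' x - (φ.prodMk 0) x)).trans ((hF1 x).trans (min_le_left _ _))
  have he : ∀ x, ‖e x‖ ≤ η := fun x => by
    have := (norm_snd_le (F' x - (φ.prodMk (0 : C(X, E2))) x)).trans
      ((hF1 x).trans (min_le_right _ _))
    have h' : ‖(F' x).2‖ ≤ η := by simpa using this
    exact h'
  let w : F → X → E2 := fun a x => (a : X →ᵇ E2) x + e x
  have hwc : ∀ a, Continuous (w a) := fun a => by fun_prop
  have hw : ∀ a, ∀ x ∈ A ∩ f ⁻¹' {y}, ψ0 x = c a → w a x ≠ 0 := by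
    intro a x hx h1 h2
    apply hF2 a (Finset.mem_univ _) x hx
    ext1
    · exact h1
    · change e x = -((a : X →ᵇ E2) x)
      exact eq_neg_of_add_eq_zero_right h2
  have hσ : ∀ a, ∃ σ > 0, ∀ x ∈ A ∩ f ⁻¹' {y}, ψ0 x = c a → σ ≤ ‖w a x‖ := by
    intro a
    have hcomp : IsCompact ((A ∩ f ⁻¹' {y}) ∩ ψ0 ⁻¹' {c a}) :=
      hK.inter_right (isClosed_singleton.preimage ψ0.continuous)
    rcases ((A ∩ f ⁻¹' {y}) ∩ ψ0 ⁻¹' {c a}).eq_empty_or_nonempty with h | h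
    · refine ⟨1, one_pos, fun x hx hx' => ?_⟩
      have : x ∈ ((A ∩ f ⁻¹' {y}) ∩ ψ0 ⁻¹' {c a}) := ⟨hx, hx'⟩
      rw [h] at this
      exact this.elim
    · obtain ⟨x0, hx0, hmin⟩ := hcomp.exists_isMinOn h (f := fun x => ‖w a x‖)
        (hwc a).norm.continuousOn
      exact ⟨_, norm_pos_iff.2 (hw a x0 hx0.1 hx0.2), fun x hx hx' => hmin ⟨hx, hx'⟩⟩
  choose σ hσ hσ' using hσ
  let θ : F → X → ℝ := fun a x => max 0 (1 - ‖ψ0 x - c a‖ / (κ / 2))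
  have hθ1 : ∀ a x, ψ0 x = c a → θ a x = 1 := fun a x h => by simp [θ, h]
  have hθ0 : ∀ a x, 0 ≤ θ a x := fun a x => le_max_left _ _
  have hθle : ∀ a x, θ a x ≤ 1 := fun a x => by
    refine max_le zero_le_one ?_
    have : 0 ≤ ‖ψ0 x - c a‖ / (κ / 2) := by positivity
    linarith
  have hθlt : ∀ a x, θ a x ≠ 0 → ‖ψ0 x - c a‖ < κ / 2 := fun a x h => by
    by_contra! hcon
    apply h
    refine max_eq_left ?_
    have : 1 ≤ ‖ψ0 x - c a‖ / (κ / 2) := (one_le_div (half_pos hκ)).2 hcon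
    linarith
  have hθu : ∀ a b x, θ a x ≠ 0 → b ≠ a → θ b x = 0 := by
    intro a b x ha hb
    by_contra hb'
    have h1 := hθlt a x ha
    have h2 := hθlt b x hb'
    have h3 := hκ' ⟨(a, b), hb.symm⟩
    have h4 : ‖c a - c b‖ ≤ ‖ψ0 x - c b‖ + ‖ψ0 x - c a‖ := by
      calc ‖c a - c b‖ = ‖(ψ0 x - c b) - (ψ0 x - c a)‖ := by congr 1; abel
        _ ≤ _ := norm_sub_le _ _
    simp only at h3
    linarith
  let p : F → X → E2 := fun a x => (θ a x * (2 * η) / max ‖w a x‖ (σ a)) • w a x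
  have hpc : ∀ a, Continuous (p a) := by
    intro a
    have : ∀ x, max ‖w a x‖ (σ a) ≠ 0 := fun x => (lt_max_of_lt_right (hσ a)).ne'
    have h2 := hwc a
    have h3 : Continuous (θ a) := by fun_prop
    exact ((h3.mul continuous_const).div (h2.norm.max continuous_const) this).smul h2
  have hpz : ∀ a x, θ a x = 0 → p a x = 0 := fun a x h => by simp [p, h]
  have hpn : ∀ a x, ‖p a x‖ ≤ 2 * η := by
    intro a x
    have h1 : 0 < max ‖w a x‖ (σ a) := lt_max_of_lt_right (hσ a)
    have h2 : ‖w a x‖ ≤ max ‖w a x‖ (σ a) := le_max_left _ _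
    have h3 := hθ0 a x
    have h4 := hθle a x
    rw [norm_smul, Real.norm_of_nonneg (by positivity), div_mul_eq_mul_div, div_le_iff₀ h1]
    have : θ a x * (2 * η) ≤ 2 * η := by nlinarith
    exact mul_le_mul this h2 (norm_nonneg _) (by positivity)
  have hsumn : ∀ x, ‖∑ a, p a x‖ ≤ 2 * η := by
    intro x
    by_cases h : ∃ a, θ a x ≠ 0
    · obtain ⟨a, ha⟩ := h
      rw [Finset.sum_eq_single a (fun b _ hb => hpz b x (hθu a b x ha hb)) (by simp)]
      exact hpn a x
    · push Not at h
      rw [Finset.sum_eq_zero fun a _ => hpz a x (h a), norm_zero]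
      positivity
  have hdn : ∀ x, ‖e x + ∑ a, p a x‖ ≤ 3 * η := fun x => by
    have h1 := he x
    have h2 := hsumn x
    have h3 := norm_add_le (e x) (∑ a, p a x)
    linarith
  have hdc : Continuous fun x => e x + ∑ a, p a x :=
    e.continuous.add (continuous_finsetSum _ fun a _ => hpc a)
  let d : X →ᵇ E2 := BoundedContinuousFunction.ofNormedAddCommGroup
    (fun x => e x + ∑ a, p a x) hdc (3 * η) hdn
  have hdx : ∀ x, d x = e x + ∑ a, p a x := fun x => rfl
  have hbig : ∀ a, ∀ x ∈ A ∩ f ⁻¹' {y}, ψ0 x = c a → η < ‖(a : X →ᵇ E2) x + d x‖ := by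
    intro a x hx h
    have h1 := hθ1 a x h
    have h2 := hσ' a x hx h
    have h3 : 0 < ‖w a x‖ := norm_pos_iff.2 (hw a x hx h)
    have : (a : X →ᵇ E2) x + d x = (1 + 2 * η / ‖w a x‖) • w a x := by
      rw [hdx, Finset.sum_eq_single a (fun b _ hb => hpz b x (hθu a b x (by simp [h1]) hb))
        (by simp), ← add_assoc, add_smul, one_smul]
      simp only [p, h1, max_eq_left h2, one_mul]
      rfl
    rw [this, norm_smul, Real.norm_of_nonneg (by positivity), add_mul, one_mul,
      div_mul_cancel₀ _ h3.ne']
    linarith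
  let Z : F → Set X := fun a => {x | x ∈ A ∧ ψ0 x = c a ∧ ‖(a : X →ᵇ E2) x + d x‖ ≤ η}
  have hZc : ∀ a, IsClosed (Z a) := fun a =>
    hA.inter ((isClosed_eq ψ0.continuous continuous_const).inter
      (isClosed_le (((a : X →ᵇ E2).continuous.add d.continuous).norm) continuous_const))
  have hfZ : ∀ a, IsClosed (f '' Z a) := fun a =>
    proper_image_closed hp (hZc a) (fun x hx => hx.1)
  refine ⟨d, hdn, ⋂ a, (f '' Z a)ᶜ, isOpen_iInter_of_finite fun a => (hfZ a).isOpen_compl, ?_, ?_⟩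
  · refine mem_iInter.2 fun a => ?_
    rintro ⟨x, ⟨hx1, hx2, hx3⟩, hxy⟩
    exact absurd hx3 (not_le.2 (hbig a x ⟨hx1, hxy⟩ hx2))
  · intro s hs
    obtain ⟨a, ha, hsa⟩ := mem_iUnion₂.1 (hF hs)
    refine ⟨ψ0 - ContinuousMap.const X (c ⟨a, ha⟩), fun x => ?_, fun x hxA hxU hn hz => ?_⟩
    · have h1 := hψ0 x
      have h2 := hcn ⟨a, ha⟩
      calc ‖(ψ0 - ContinuousMap.const X (c ⟨a, ha⟩)) x - φ x‖
          = ‖(ψ0 x - φ x) - c ⟨a, ha⟩‖ := by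
            congr 1; simp only [ContinuousMap.sub_apply, ContinuousMap.const_apply]; abel
        _ ≤ _ := norm_sub_le _ _
        _ ≤ ε := by linarith
    · have hz' : ψ0 x = c ⟨a, ha⟩ := by
        simpa [sub_eq_zero] using hz
      refine (mem_iInter.1 hxU ⟨a, ha⟩) ⟨x, ⟨hxA, hz', ?_⟩, rfl⟩
      have h1 : ‖a x - s x‖ ≤ η / 2 := by
        rw [← dist_eq_norm]
        have := BoundedContinuousFunction.dist_coe_le_dist (f := a) (g := s) x
        rw [mem_ball, dist_comm] at hsa
        linarith
      calc ‖a x + d x‖ = ‖(a x - s x) + (s x + d x)‖ := by congr 1; abel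
        _ ≤ _ := norm_add_le _ _
        _ ≤ η := by linarith

lemma exists_zero_fun {T : Type*} [TopologicalSpace T] [TopologicalSpace.MetrizableSpace T]
    {C : Set T} (hC : IsClosed C) :
    ∃ d : C(T, ℝ), (∀ x, d x = 0 ↔ x ∈ C) ∧ ∀ x, 0 ≤ d x := by
  obtain ⟨d, hd, hd'⟩ :=
    perfectlyNormalSpace_iff_forall_isClosed_preimage_zero.1 (inferInstance : PerfectlyNormalSpace T)
      C hC
  refine ⟨d, fun x => ?_, fun x => (hd' x).1⟩
  rw [hd]; rfl

lemma hemmingsen {T : Type*} [TopologicalSpace T] {p : ℕ}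
    (h : ∀ U : Fin (p + 2) → Set T, (∀ j, IsOpen (U j)) → ⋃ j, U j = univ →
      ∃ V : Fin (p + 2) → Set T, (∀ j, IsOpen (V j)) ∧ (∀ j, V j ⊆ U j) ∧ ⋃ j, V j = univ ∧
        ⋂ j, V j = ∅) : CovDimLENat T p := by
  classical
  intro 𝒰 hfin hopen hcov
  have : Finite 𝒰 := hfin
  have : Fintype 𝒰 := Fintype.ofFinite _
  have key : ∀ J : Finset (Fin (p + 2) ↪ 𝒰), ∃ V : 𝒰 → Set T, (∀ i, IsOpen (V i)) ∧
      (∀ i, V i ⊆ i.1) ∧ ⋃ i, V i = univ ∧ ∀ e ∈ J, ⋂ j, V (e j) = ∅ := by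
    intro J
    induction J using Finset.induction_on with
    | empty =>
      refine ⟨fun i => i.1, fun i => hopen _ i.2, fun i => subset_rfl, ?_, by simp⟩
      rw [← sUnion_eq_iUnion, hcov]
    | insert e J he ih =>
      obtain ⟨V, hVo, hVU, hVc, hVJ⟩ := ih
      let r : 𝒰 → Fin (p + 2) := Function.invFun e
      have hr : ∀ j, r (e j) = j := Function.leftInverse_invFun e.injective
      obtain ⟨W, hWo, hWU, hWc, hWe⟩ := h (fun j => ⋃ i : {i // r i = j}, V i)
        (fun j => isOpen_iUnion fun i => hVo _) (by
          rw [← univ_subset_iff]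
          intro x _
          obtain ⟨i, hi⟩ := mem_iUnion.1 (hVc.ge (mem_univ x))
          exact mem_iUnion.2 ⟨r i, mem_iUnion.2 ⟨⟨i, rfl⟩, hi⟩⟩)
      refine ⟨fun i => V i ∩ W (r i), fun i => (hVo i).inter (hWo _),
        fun i => inter_subset_left.trans (hVU i), ?_, ?_⟩
      · rw [← univ_subset_iff]
        intro x _
        obtain ⟨j, hj⟩ := mem_iUnion.1 (hWc.ge (mem_univ x))
        obtain ⟨⟨i, rfl⟩, hi⟩ := mem_iUnion.1 (hWU j hj)
        exact mem_iUnion.2 ⟨i, hi, hj⟩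
      · intro e' he'
        rw [← subset_empty_iff]
        rcases Finset.mem_insert.1 he' with rfl | he'
        · rw [← hWe]
          refine iInter_mono fun j => ?_
          change V (e' j) ∩ W (r (e' j)) ⊆ W j
          rw [hr]
          exact inter_subset_right
        · rw [← hVJ e' he']
          exact iInter_mono fun j => inter_subset_left
  obtain ⟨V, hVo, hVU, hVc, hVJ⟩ := key Finset.univ
  refine ⟨range V, ?_, ?_, ?_, fun x => ⟨?_, ?_⟩⟩
  · rintro _ ⟨i, rfl⟩; exact hVo i
  · rw [sUnion_range, hVc]
  · rintro _ ⟨i, rfl⟩; exact ⟨i.1, i.2, hVU i⟩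
  · exact (finite_range V).subset (sep_subset _ _)
  · have h1 : {W ∈ range V | x ∈ W} ⊆ V '' {i | x ∈ V i} := by
      rintro _ ⟨⟨i, rfl⟩, hi⟩
      exact ⟨i, hi, rfl⟩
    refine (ncard_le_ncard h1 (toFinite _)).trans ((ncard_image_le (toFinite _)).trans ?_)
    by_contra! hcon
    have h2 : p + 2 ≤ Fintype.card {i | x ∈ V i} := by
      rw [← Nat.card_eq_fintype_card, Nat.card_coe_set_eq]; omega
    obtain ⟨e⟩ := Function.Embedding.nonempty_of_card_le
      (α := Fin (p + 2)) (β := {i | x ∈ V i}) (by simpa using h2)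
    have h3 := hVJ (e.trans (Function.Embedding.subtype _)) (Finset.mem_univ _)
    rw [← Set.mem_empty_iff_false x, ← h3]
    exact mem_iInter.2 fun j => (e j).2

lemma countable_sum {T : Type*} [TopologicalSpace T] [TopologicalSpace.MetrizableSpace T]
    {ι : Type*} [Finite ι] [Nonempty ι] (F : ℕ → Set T) (hF : ⋃ i, F i = univ)
    (h : ∀ i, ∀ U : ι → Set T, (∀ j, IsOpen (U j)) → ⋃ j, U j = univ →
      ∃ V : ι → Set T, (∀ j, IsOpen (V j)) ∧ (∀ j, V j ⊆ U j) ∧ ⋃ j, V j = univ ∧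
        F i ∩ ⋂ j, V j = ∅)
    (U : ι → Set T) (hU : ∀ j, IsOpen (U j)) (hc : ⋃ j, U j = univ) :
      ∃ V : ι → Set T, (∀ j, IsOpen (V j)) ∧ (∀ j, V j ⊆ U j) ∧ ⋃ j, V j = univ ∧
        ⋂ j, V j = ∅ := by
  classical
  let St := {U : ι → Set T // (∀ j, IsOpen (U j)) ∧ ⋃ j, U j = univ}
  have step : ∀ (i : ℕ) (s : St), ∃ s' : St, (∀ j, closure (s'.1 j) ⊆ s.1 j) ∧
      F i ∩ ⋂ j, closure (s'.1 j) = ∅ := by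
    rintro i ⟨U, hU, hc⟩
    obtain ⟨V, hVo, hVU, hVc, hVe⟩ := h i U hU hc
    obtain ⟨W, hWc, hWo, hWV⟩ := exists_iUnion_eq_closure_subset hVo (fun x => toFinite _) hVc
    refine ⟨⟨W, hWo, hWc⟩, fun j => (hWV j).trans (hVU j), ?_⟩
    rw [← subset_empty_iff, ← hVe]
    exact inter_subset_inter_right _ (iInter_mono hWV)
  choose nxt hn1 hn2 using step
  let seq : ℕ → St := fun i => Nat.rec ⟨U, hU, hc⟩ (fun i s => nxt i s) i
  have hs1 : ∀ i j, closure ((seq (i + 1)).1 j) ⊆ (seq i).1 j := fun i j => hn1 i (seq i) j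
  have hs2 : ∀ i, F i ∩ ⋂ j, closure ((seq (i + 1)).1 j) = ∅ := fun i => hn2 i (seq i)
  have hanti : ∀ j, Antitone fun i => (seq i).1 j := fun j =>
    antitone_nat_of_succ_le fun i => subset_closure.trans (hs1 i j)
  let Z : ι → Set T := fun j => ⋂ i, closure ((seq (i + 1)).1 j)
  have hZc : ∀ j, IsClosed (Z j) := fun j => isClosed_iInter fun i => isClosed_closure
  have hZU : ∀ j, Z j ⊆ U j := fun j => (iInter_subset _ 0).trans (hs1 0 j)
  have hZcov : ∀ x, ∃ j, x ∈ Z j := by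
    intro x
    by_contra! hcon
    have : ∀ j, ∃ i, x ∉ (seq i).1 j := by
      intro j
      have := hcon j
      simp only [Z, mem_iInter, not_forall] at this
      obtain ⟨i, hi⟩ := this
      exact ⟨i + 1, fun hx => hi (subset_closure hx)⟩
    choose N hN using this
    obtain ⟨M, hM⟩ := (finite_range N).bddAbove
    obtain ⟨j, hj⟩ := mem_iUnion.1 ((seq M).2.2.ge (mem_univ x))
    exact hN j (hanti j (hM (mem_range_self j)) hj)
  have hZe : ∀ x, ∃ j, x ∉ Z j := by
    intro x
    by_contra! hcon
    obtain ⟨i, hi⟩ := mem_iUnion.1 (hF.ge (mem_univ x))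
    rw [← Set.mem_empty_iff_false x, ← hs2 i]
    exact ⟨hi, mem_iInter.2 fun j => mem_iInter.1 (hcon j) i⟩
  choose d hd hd0 using fun j => exists_zero_fun (hZc j)
  refine ⟨fun j => U j ∩ ⋃ l, {x | d j x < d l x}, fun j => (hU j).inter
    (isOpen_iUnion fun l => isOpen_lt (d j).continuous (d l).continuous),
    fun j => inter_subset_left, ?_, ?_⟩
  · rw [← univ_subset_iff]
    intro x _
    obtain ⟨j, hj⟩ := hZcov x
    obtain ⟨l, hl⟩ := hZe x
    refine mem_iUnion.2 ⟨j, hZU j hj, mem_iUnion.2 ⟨l, ?_⟩⟩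
    have h1 := (hd j x).2 hj
    have h2 : d l x ≠ 0 := fun h => hl ((hd l x).1 h)
    have h3 := lt_of_le_of_ne (hd0 l x) h2.symm
    change d j x < d l x
    rw [h1]; exact h3
  · rw [← subset_empty_iff]
    intro x hx
    obtain ⟨j, hj⟩ := Finite.exists_max fun j => d j x
    obtain ⟨l, hl⟩ := mem_iUnion.1 (mem_iInter.1 hx j).2
    exact absurd (hj l) (not_le.2 hl)

lemma source_dense_of {X E : Type*} [TopologicalSpace X] [PseudoMetricSpace E]
    {G : Set (X →ᵇ E)} (h : ∀ (g : X →ᵇ E) (α : X → ℝ), Continuous α → (∀ x, 0 < α x) →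
      ∃ h ∈ G, ∀ x, dist (h x) (g x) ≤ α x) : @Dense _ (sourceLimitation X E) G := by
  refine (@dense_iff_inter_open _ (sourceLimitation X E) G).2 ?_
  rintro U hU ⟨g, hg⟩
  obtain ⟨α, hα, hα0, hα'⟩ := hU g hg
  obtain ⟨h, hG, hh⟩ := h g α hα hα0
  exact ⟨h, hα' h hh, hG⟩

lemma source_baire {X E : Type*} [TopologicalSpace X] [MetricSpace E] [CompleteSpace E]
    (O : ℕ → Set (X →ᵇ E)) (ho : ∀ i, ∀ g ∈ O i, ∃ α : X → ℝ, Continuous α ∧ (∀ x, 0 < α x) ∧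
      ∀ h : X →ᵇ E, (∀ x, dist (h x) (g x) ≤ α x) → h ∈ O i)
    (hd : ∀ i, ∀ (g : X →ᵇ E) (α : X → ℝ), Continuous α → (∀ x, 0 < α x) →
      ∃ h ∈ O i, ∀ x, dist (h x) (g x) ≤ α x)
    (g : X →ᵇ E) (α : X → ℝ) (hα : Continuous α) (hα0 : ∀ x, 0 < α x) :
    ∃ h ∈ ⋂ i, O i, ∀ x, dist (h x) (g x) ≤ α x := by
  let St := {s : (X →ᵇ E) × (X → ℝ) // Continuous s.2 ∧ ∀ x, 0 < s.2 x}
  have step : ∀ (i : ℕ) (s : St), ∃ s' : St, (∀ x, dist (s'.1.1 x) (s.1.1 x) ≤ s.1.2 x / 2) ∧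
      (∀ x, s'.1.2 x ≤ s.1.2 x / 2) ∧
      ∀ h : X →ᵇ E, (∀ x, dist (h x) (s'.1.1 x) ≤ s'.1.2 x) → h ∈ O i := by
    rintro i ⟨⟨g, α⟩, hα, hα0⟩
    obtain ⟨h, hO, hh⟩ := hd i g (fun x => α x / 2) (hα.div_const 2) (fun x => half_pos (hα0 x))
    obtain ⟨β, hβ, hβ0, hβ'⟩ := ho i h hO
    refine ⟨⟨⟨h, fun x => min (β x) (α x / 2)⟩, hβ.min (hα.div_const 2),
      fun x => lt_min (hβ0 x) (half_pos (hα0 x))⟩, hh, fun x => min_le_right _ _, fun h' hh' =>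
        hβ' h' fun x => (hh' x).trans (min_le_left _ _)⟩
  choose nxt hn1 hn2 hn3 using step
  let s0 : St := ⟨⟨g, fun x => min 1 (α x)⟩, continuous_const.min hα,
    fun x => lt_min one_pos (hα0 x)⟩
  let seq : ℕ → St := fun i => Nat.rec s0 (fun i s => nxt i s) i
  have h1 : ∀ i x, dist ((seq (i + 1)).1.1 x) ((seq i).1.1 x) ≤ (seq i).1.2 x / 2 :=
    fun i => hn1 i (seq i)
  have h2 : ∀ i x, (seq (i + 1)).1.2 x ≤ (seq i).1.2 x / 2 := fun i => hn2 i (seq i)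
  have h3 : ∀ i, ∀ h : X →ᵇ E, (∀ x, dist (h x) ((seq (i + 1)).1.1 x) ≤ (seq (i + 1)).1.2 x) →
      h ∈ O i := fun i => hn3 i (seq i)
  have h4 : ∀ i x, (seq i).1.2 x ≤ 1 / 2 ^ i := by
    intro i x
    induction i with
    | zero => simp [seq, s0]
    | succ i ih =>
      refine (h2 i x).trans ?_
      rw [pow_succ, ← div_div]
      linarith
  have h5 : ∀ i, dist (seq i).1.1 (seq (i + 1)).1.1 ≤ 1 / 2 / 2 ^ i := by
    intro i
    rw [BoundedContinuousFunction.dist_le (by positivity)]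
    intro x
    rw [dist_comm]
    refine (h1 i x).trans ?_
    have := h4 i x
    rw [div_right_comm]
    linarith
  obtain ⟨h, hh⟩ := cauchySeq_tendsto_of_complete (cauchySeq_of_le_geometric_two h5)
  have h6 : ∀ i m x, dist ((seq (i + m)).1.1 x) ((seq i).1.1 x) ≤
      (seq i).1.2 x - (seq (i + m)).1.2 x := by
    intro i m x
    induction m with
    | zero => simp
    | succ m ih =>
      have a1 := h1 (i + m) x
      have a2 := h2 (i + m) x
      have a3 := dist_triangle ((seq (i + m + 1)).1.1 x) ((seq (i + m)).1.1 x) ((seq i).1.1 x)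
      rw [← add_assoc]
      linarith
  have h7 : ∀ i x, dist (h x) ((seq i).1.1 x) ≤ (seq i).1.2 x := by
    intro i x
    have t1 : Filter.Tendsto (fun m => (seq m).1.1 x) Filter.atTop (𝓝 (h x)) :=
      ((BoundedContinuousFunction.lipschitz_eval_const x).continuous.tendsto h).comp hh
    refine le_of_tendsto (t1.dist tendsto_const_nhds) ?_
    filter_upwards [Filter.eventually_ge_atTop i] with m hm
    obtain ⟨j, rfl⟩ := Nat.exists_eq_add_of_le hm
    have := h6 i j x
    have := (seq (i + j)).2.2 x
    linarith
  exact ⟨h, mem_iInter.2 fun i => h3 i h (h7 (i + 1)), fun x => (h7 0 x).trans (min_le_right _ _)⟩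

/-- Maps whose joint fibers with `f` inside `A` can be pushed off zero. -/
def GoodSet {X Y E1 E2 : Type*} [TopologicalSpace X] [NormedAddCommGroup E1]
    [NormedAddCommGroup E2] (f : X → Y) (A : Set X) (φ : C(X, E1)) (ε : ℝ) : Set (X →ᵇ E2) :=
  {h | ∀ y z, ∃ ψ : C(X, E1), (∀ x, ‖ψ x - φ x‖ ≤ ε) ∧
    ∀ x ∈ A, f x = y → h x = z → ψ x ≠ 0}

lemma good_open {X Y E1 E2 : Type*} [TopologicalSpace X] [TopologicalSpace Y]
    [TopologicalSpace.MetrizableSpace Y]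
    [NormedAddCommGroup E1] [NormedAddCommGroup E2] [NormedSpace ℝ E2] [FiniteDimensional ℝ E2]
    {f : X → Y} (hf : Continuous f) {A : Set X} (hA : IsClosed A)
    (hp : IsProperMap (fun a : A => f a)) (φ : C(X, E1)) {ε : ℝ} (hε : 0 < ε)
    (h : X →ᵇ E2) (hh : h ∈ GoodSet f A φ ε) :
    ∃ α : X → ℝ, Continuous α ∧ (∀ x, 0 < α x) ∧
      ∀ h' : X →ᵇ E2, (∀ x, dist (h' x) (h x) ≤ α x) → h' ∈ GoodSet f A φ ε := by
  classical
  have : ProperSpace E2 := FiniteDimensional.proper_real E2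
  have : ParacompactSpace Y := by
    letI := TopologicalSpace.metrizableSpaceMetric Y
    infer_instance
  let T : Y → Set ℝ := fun y => {ρ | 0 < ρ ∧ ∀ z, ∃ ψ : C(X, E1), (∀ x, ‖ψ x - φ x‖ ≤ ε) ∧
    ∀ x ∈ A, f x = y → dist (h x) z ≤ ρ → ψ x ≠ 0}
  have hconv : ∀ y, Convex ℝ (T y) := by
    intro y
    refine Set.OrdConnected.convex ⟨?_⟩
    rintro a ⟨ha, -⟩ b ⟨-, hb⟩ c ⟨hac, hcb⟩
    refine ⟨ha.trans_le hac, fun z => ?_⟩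
    obtain ⟨ψ, h1, h2⟩ := hb z
    exact ⟨ψ, h1, fun x hx hy hd => h2 x hx hy (hd.trans hcb)⟩
  have hp2 : IsProperMap (fun a : A => (f a, h a)) := by
    refine isProperMap_of_comp_of_t2 (g := Prod.fst) ?_ continuous_fst hp
    exact (hf.prodMk h.continuous).comp continuous_subtype_val
  have hloc : ∀ y, ∃ c : ℝ, ∀ᶠ y' in 𝓝 y, c ∈ T y' := by
    intro y
    choose ψ hψ1 hψ2 using hh y
    have hnb : ∀ z, ∃ U ∈ 𝓝 y, ∃ r > 0, ∀ x ∈ A, f x ∈ U → h x ∈ ball z r → ψ z x ≠ 0 := by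
      intro z
      have hcl : IsClosed ((fun x => (f x, h x)) '' {x | x ∈ A ∧ ψ z x = 0}) :=
        proper_image_closed (f := fun x => (f x, h x)) hp2
          (hA.inter (isClosed_eq (ψ z).continuous continuous_const)) (fun x hx => hx.1)
      have hmem : ((fun x => (f x, h x)) '' {x | x ∈ A ∧ ψ z x = 0})ᶜ ∈ 𝓝 (y, z) := by
        refine hcl.isOpen_compl.mem_nhds ?_
        rintro ⟨x, ⟨hx1, hx2⟩, hx3⟩
        rw [Prod.mk.injEq] at hx3
        exact hψ2 z x hx1 hx3.1 hx3.2 hx2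
      rw [mem_nhds_prod_iff] at hmem
      obtain ⟨U, hU, V, hV, hUV⟩ := hmem
      obtain ⟨r, hr, hrV⟩ := Metric.mem_nhds_iff.1 hV
      refine ⟨U, hU, r, hr, fun x hx hxU hxr h0 => ?_⟩
      exact hUV (show (f x, h x) ∈ U ×ˢ V from ⟨hxU, hrV hxr⟩) ⟨x, ⟨hx, h0⟩, rfl⟩
    choose U hU r hr hUr using hnb
    obtain ⟨t, -, ht⟩ := (isCompact_closedBall (0 : E2) (‖h‖ + 1)).elim_nhds_subcover
      (fun z => ball z (r z / 2)) (fun z _ => ball_mem_nhds z (half_pos (hr z)))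
    obtain ⟨c, hc, hc'⟩ := finite_pos_le (fun z : t => r z / 2) (fun z => half_pos (hr z))
    refine ⟨min 1 c, ?_⟩
    have hev : ∀ᶠ y' in 𝓝 y, ∀ z ∈ t, y' ∈ U z :=
      (Filter.eventually_all_finset t).2 fun z _ => hU z
    filter_upwards [hev] with y' hy'
    refine ⟨lt_min one_pos hc, fun z' => ?_⟩
    by_cases hz' : z' ∈ closedBall (0 : E2) (‖h‖ + 1)
    · obtain ⟨z, hz, hzz⟩ := mem_iUnion₂.1 (ht hz')
      refine ⟨ψ z, hψ1 z, fun x hx hxy hd => hUr z x hx (hxy ▸ hy' z hz) ?_⟩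
      have h1 := hc' ⟨z, hz⟩
      have h2 := hd.trans (min_le_right _ _)
      rw [mem_ball] at hzz ⊢
      have h3 := dist_triangle (h x) z' z
      simp only at h1
      linarith
    · refine ⟨φ, fun x => by simpa using hε.le, fun x hx hxy hd => ?_⟩
      exfalso
      apply hz'
      rw [mem_closedBall_zero_iff]
      have h1 := hd.trans (min_le_left _ _)
      have h2 := h.norm_coe_le_norm x
      rw [dist_comm, dist_eq_norm] at h1
      have h3 := norm_add_le (z' - h x) (h x)
      rw [sub_add_cancel] at h3
      linarith
  obtain ⟨ρ, hρ⟩ := exists_continuous_forall_mem_convex_of_local_const hconv hloc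
  refine ⟨fun x => ρ (f x), ρ.continuous.comp hf, fun x => (hρ _).1, fun h' hh' y z => ?_⟩
  obtain ⟨ψ, h1, h2⟩ := (hρ y).2 z
  refine ⟨ψ, h1, fun x hx hxy hxz => h2 x hx hxy ?_⟩
  rw [← hxz, dist_comm, ← hxy]
  exact hh' x

/-- Locally, the family of sets of perturbations is contained in a compact set. -/
def LocComp {X Y E2 : Type*} [TopologicalSpace X] [TopologicalSpace Y] [NormedAddCommGroup E2]
    (P : Y → Set (X →ᵇ E2)) : Prop :=
  ∀ y, ∃ W ∈ 𝓝 y, ∃ C : Set (X →ᵇ E2), IsCompact C ∧ ∀ y' ∈ W, P y' ⊆ C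

lemma locComp_next {X Y E2 : Type*} [TopologicalSpace X] [TopologicalSpace Y]
    [NormedAddCommGroup E2] [NormedSpace ℝ E2] {P : Y → Set (X →ᵇ E2)} (hP : LocComp P)
    {U : Y → Set Y} (hU : LocallyFinite U) (d : Y → (X →ᵇ E2)) :
    LocComp (fun y => {t | ∃ s ∈ P y, ∃ i, y ∈ U i ∧ ∃ l ∈ Icc (0 : ℝ) 1, t = s + l • d i}) := by
  intro y
  obtain ⟨W, hW, C, hC, hPC⟩ := hP y
  obtain ⟨N, hN, hfin⟩ := hU y
  refine ⟨W ∩ N, Filter.inter_mem hW hN,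
    ⋃ i ∈ {i | (U i ∩ N).Nonempty}, (fun p : (X →ᵇ E2) × ℝ => p.1 + p.2 • d i) '' (C ×ˢ Icc 0 1),
    ?_, ?_⟩
  · refine hfin.isCompact_biUnion fun i _ => (hC.prod isCompact_Icc).image ?_
    fun_prop
  · rintro y' ⟨hy1, hy2⟩ t ⟨s, hs, i, hi, l, hl, rfl⟩
    exact mem_iUnion₂.2 ⟨i, ⟨y', hi, hy2⟩, ⟨(s, l), ⟨hPC y' hy1 hs, hl⟩, rfl⟩⟩

lemma stage_step {X Y : Type*} [TopologicalSpace X] [TopologicalSpace.MetrizableSpace X]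
    [TopologicalSpace Y] [TopologicalSpace.MetrizableSpace Y] {n : ℕ} {E1 E2 : Type*}
    [NormedAddCommGroup E1] [NormedSpace ℝ E1] [FiniteDimensional ℝ E1] [Nontrivial E1]
    [NormedAddCommGroup E2] [NormedSpace ℝ E2] [FiniteDimensional ℝ E2]
    (hdim : n < Module.finrank ℝ E1 + Module.finrank ℝ E2)
    {f : X → Y} {A : Set X} (hA : IsClosed A) (hp : IsProperMap (fun a : A => f a))
    (hd : ∀ y, CovDimLENat (f ⁻¹' {y}) n) (φ : C(X, E1)) {ε : ℝ} (hε : 0 < ε)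
    (g : X →ᵇ E2) {α : X → ℝ} (hα : Continuous α) (hα0 : ∀ x, 0 < α x) (R : ℝ)
    {P : Y → Set (X →ᵇ E2)} (hP : LocComp P) {η : ℝ} (hη : 0 < η) :
    ∃ (U : Y → Set Y) (d : Y → (X →ᵇ E2)), (∀ i, IsOpen (U i)) ∧ ⋃ i, U i = univ ∧
      LocallyFinite U ∧ (∀ i x, ‖d i x‖ ≤ 3 * η) ∧
      ∀ i, ∀ y ∈ U i, ∀ s ∈ P y, ∀ z ∈ closedBall (0 : E2) R,
        ∃ ψ : C(X, E1), (∀ x, ‖ψ x - φ x‖ ≤ ε) ∧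
          ∀ x ∈ A, f x = y → ‖(α x)⁻¹ • (g x - z) + s x + d i x‖ ≤ η / 2 → ψ x ≠ 0 := by
  have : ProperSpace E2 := FiniteDimensional.proper_real E2
  have : ParacompactSpace Y := by
    let _ := TopologicalSpace.metrizableSpaceMetric Y
    infer_instance
  have hαi : Continuous fun x => (α x)⁻¹ := hα.inv₀ fun x => (hα0 x).ne'
  have loc : ∀ y, ∃ (U : Set Y) (d : X →ᵇ E2), IsOpen U ∧ y ∈ U ∧ (∀ x, ‖d x‖ ≤ 3 * η) ∧
      ∀ y' ∈ U, ∀ s ∈ P y', ∀ z ∈ closedBall (0 : E2) R,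
        ∃ ψ : C(X, E1), (∀ x, ‖ψ x - φ x‖ ≤ ε) ∧
          ∀ x ∈ A, f x = y' → ‖(α x)⁻¹ • (g x - z) + s x + d x‖ ≤ η / 2 → ψ x ≠ 0 := by
    intro y
    obtain ⟨W, hW, C, hC, hPC⟩ := hP y
    obtain ⟨M, hM⟩ := (proper_fiber_compact hp y).exists_bound_of_continuousOn hαi.continuousOn
    let β : X → ℝ := fun x => min (α x)⁻¹ (|M| + 1)
    have hβc : Continuous β := hαi.min continuous_const
    have hβ0 : ∀ x, 0 ≤ β x := fun x => le_min (inv_nonneg.2 (hα0 x).le) (by positivity)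
    have hβle : ∀ x, β x ≤ |M| + 1 := fun x => min_le_right _ _
    let Φ : E2 → (X →ᵇ E2) := fun z => BoundedContinuousFunction.ofNormedAddCommGroup
      (fun x => β x • (g x - z)) (hβc.smul (g.continuous.sub continuous_const))
      ((|M| + 1) * (‖g‖ + ‖z‖)) (fun x => by
        rw [norm_smul, Real.norm_of_nonneg (hβ0 x)]
        refine mul_le_mul (hβle x) ?_ (norm_nonneg _) (by positivity)
        exact (norm_sub_le _ _).trans (add_le_add_left (g.norm_coe_le_norm x) _))
    have hΦ : Continuous Φ := by
      obtain ⟨K, hK⟩ : ∃ K : NNReal, (K : ℝ) = |M| + 1 :=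
        ⟨Real.toNNReal _, Real.coe_toNNReal _ (by positivity)⟩
      refine (LipschitzWith.of_dist_le_mul (K := K) fun z z' => ?_).continuous
      rw [hK]
      rw [BoundedContinuousFunction.dist_le (by positivity)]
      intro x
      change dist (β x • (g x - z)) (β x • (g x - z')) ≤ (|M| + 1) * dist z z'
      rw [dist_smul₀, Real.norm_of_nonneg (hβ0 x), dist_sub_left]
      exact mul_le_mul_of_nonneg_right (hβle x) dist_nonneg
    have hS : IsCompact ((fun p : E2 × (X →ᵇ E2) => Φ p.1 + p.2) '' (closedBall 0 R ×ˢ C)) :=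
      ((isCompact_closedBall _ _).prod hC).image
        ((hΦ.comp continuous_fst).add continuous_snd)
    obtain ⟨d, hdn, U, hU, hyU, hUd⟩ := local_step hdim hA hp y (hd y) φ hε hS hη
    have hcl : IsClosed (f '' {x | x ∈ A ∧ |M| + 1 ≤ (α x)⁻¹}) :=
      proper_image_closed hp (hA.inter (isClosed_le continuous_const hαi)) fun x hx => hx.1
    refine ⟨U ∩ interior W ∩ (f '' {x | x ∈ A ∧ |M| + 1 ≤ (α x)⁻¹})ᶜ, d,
      (hU.inter isOpen_interior).inter hcl.isOpen_compl,
      ⟨⟨hyU, mem_interior_iff_mem_nhds.2 hW⟩, ?_⟩, hdn, ?_⟩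
    · rintro ⟨x, ⟨hxA, hx⟩, hxy⟩
      have h1 := (le_abs_self _).trans (hM x ⟨hxA, hxy⟩)
      have h2 := le_abs_self M
      linarith
    · rintro y' ⟨⟨hy1, hy2⟩, hy3⟩ s hs z hz
      obtain ⟨ψ, h1, h2⟩ := hUd (Φ z + s) ⟨(z, s), ⟨hz, hPC y' (interior_subset hy2) hs⟩, rfl⟩
      refine ⟨ψ, h1, fun x hxA hxy hn => h2 x hxA (hxy ▸ hy1) ?_⟩
      have hb : β x = (α x)⁻¹ := by
        refine min_eq_left ?_
        by_contra! hcon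
        exact hy3 ⟨x, ⟨hxA, hcon.le⟩, hxy⟩
      change ‖β x • (g x - z) + s x + d x‖ ≤ η / 2
      rw [hb]
      exact hn
  choose U d hU hyU hdn hprop using loc
  obtain ⟨V, hVo, hVc, hVf, hVU⟩ := precise_refinement U hU
    (univ_subset_iff.1 fun y _ => mem_iUnion.2 ⟨y, hyU y⟩)
  exact ⟨V, d, hVo, hVc, hVf, hdn, fun i y hy => hprop i y (hVU i hy)⟩

lemma stages {X Y : Type*} [TopologicalSpace X] [TopologicalSpace.MetrizableSpace X]
    [TopologicalSpace Y] [TopologicalSpace.MetrizableSpace Y] {n : ℕ} {E1 E2 : Type*}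
    [NormedAddCommGroup E1] [NormedSpace ℝ E1] [FiniteDimensional ℝ E1] [Nontrivial E1]
    [NormedAddCommGroup E2] [NormedSpace ℝ E2] [FiniteDimensional ℝ E2]
    (hdim : n < Module.finrank ℝ E1 + Module.finrank ℝ E2)
    {f : X → Y} {A : Set X} (hA : IsClosed A) (hp : IsProperMap (fun a : A => f a))
    (hd : ∀ y, CovDimLENat (f ⁻¹' {y}) n) (φ : C(X, E1)) {ε : ℝ} (hε : 0 < ε)
    (g : X →ᵇ E2) {α : X → ℝ} (hα : Continuous α) (hα0 : ∀ x, 0 < α x) (R : ℝ)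
    (η : ℕ → ℝ) (hη : ∀ m, 0 < η m) :
    ∃ (P : ℕ → Y → Set (X →ᵇ E2)) (U : ℕ → Y → Set Y) (d : ℕ → Y → (X →ᵇ E2)),
      (∀ y, 0 ∈ P 0 y) ∧
      (∀ m y i s, ∀ l ∈ Icc (0 : ℝ) 1, s ∈ P m y → y ∈ U m i → s + l • d m i ∈ P (m + 1) y) ∧
      (∀ m i, IsOpen (U m i)) ∧ (∀ m, ⋃ i, U m i = univ) ∧
      (∀ m i x, ‖d m i x‖ ≤ 3 * η m) ∧
      ∀ m i, ∀ y ∈ U m i, ∀ s ∈ P m y, ∀ z ∈ closedBall (0 : E2) R,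
        ∃ ψ : C(X, E1), (∀ x, ‖ψ x - φ x‖ ≤ ε) ∧
          ∀ x ∈ A, f x = y → ‖(α x)⁻¹ • (g x - z) + s x + d m i x‖ ≤ η m / 2 → ψ x ≠ 0 := by
  choose U d h1 h2 h3 h4 h5 using fun (m : ℕ) (s : {P : Y → Set (X →ᵇ E2) // LocComp P}) =>
    stage_step hdim hA hp hd φ hε g hα hα0 R s.2 (hη m)
  let P0 : {P : Y → Set (X →ᵇ E2) // LocComp P} := ⟨fun _ => {0}, fun y =>
    ⟨univ, Filter.univ_mem, {0}, isCompact_singleton, fun _ _ => subset_rfl⟩⟩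
  let seq : ℕ → {P : Y → Set (X →ᵇ E2) // LocComp P} := fun m =>
    Nat.rec P0 (fun m s => ⟨_, locComp_next s.2 (h3 m s) (d m s)⟩) m
  refine ⟨fun m => (seq m).1, fun m => U m (seq m), fun m => d m (seq m), fun y => rfl,
    fun m y i s l hl hs hy => ⟨s, hs, i, hy, l, hl, rfl⟩, fun m => h1 m _, fun m => h2 m _,
    fun m => h4 m _, fun m => h5 m _⟩

lemma cspace_index {Y : Type*} [TopologicalSpace Y] (hY : IsCSpace Y) {I : Type*}
    (U : ℕ → I → Set Y) (hU : ∀ m i, IsOpen (U m i)) (hc : ∀ m, ⋃ i, U m i = univ) :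
    ∃ (O : ℕ → Set Y) (idx : ℕ → Y → I), (∀ m, IsOpen (O m)) ∧ ⋃ m, O m = univ ∧
      (∀ m y, y ∈ U m (idx m y)) ∧ ∀ m, ∀ y ∈ O m, ∀ᶠ y' in 𝓝 y, idx m y' = idx m y := by
  classical
  obtain ⟨𝒱, h𝒱, hcov⟩ := hY (fun m => range (U m)) (fun m => ⟨by
    rintro _ ⟨i, rfl⟩; exact hU m i, by rw [sUnion_range, hc]⟩)
  have hi : ∀ m (V : 𝒱 m), ∃ i, V.1 ⊆ U m i := by
    intro m V
    obtain ⟨_, ⟨i, rfl⟩, hi⟩ := (h𝒱 m).2.1 V.1 V.2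
    exact ⟨i, hi⟩
  choose i hi using hi
  have ha : ∀ m y, ∃ i, y ∈ U m i := fun m y => mem_iUnion.1 ((hc m).ge (mem_univ y))
  choose a ha using ha
  let idx : ℕ → Y → I := fun m y => if h : ∃ V : 𝒱 m, y ∈ V.1 then i m h.choose else a m y
  have hidx : ∀ m (V : 𝒱 m), ∀ y ∈ V.1, idx m y = i m V := by
    intro m V y hy
    have h : ∃ V : 𝒱 m, y ∈ V.1 := ⟨V, hy⟩
    have : h.choose = V := by
      by_contra hne
      have := (h𝒱 m).2.2 h.choose.2 V.2 (fun h => hne (Subtype.ext h))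
      exact this.le_bot ⟨h.choose_spec, hy⟩
    simp only [idx, dif_pos h, this]
  refine ⟨fun m => ⋃₀ 𝒱 m, idx, fun m => isOpen_sUnion (h𝒱 m).1, ?_, ?_, ?_⟩
  · rw [← hcov, sUnion_iUnion]
  · intro m y
    by_cases h : ∃ V : 𝒱 m, y ∈ V.1
    · obtain ⟨V, hV⟩ := h
      rw [hidx m V y hV]
      exact hi m V hV
    · simp only [idx, dif_neg h]
      exact ha m y
  · rintro m y ⟨V, hV, hy⟩
    filter_upwards [((h𝒱 m).1 V hV).mem_nhds hy] with y' hy'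
    rw [hidx m ⟨V, hV⟩ y' hy', hidx m ⟨V, hV⟩ y hy]

lemma cspace_weights {Y : Type*} [TopologicalSpace Y] [TopologicalSpace.MetrizableSpace Y]
    (O : ℕ → Set Y) (hO : ∀ m, IsOpen (O m)) (hc : ⋃ m, O m = univ) :
    ∃ w : ℕ → Y → ℝ, (∀ m, Continuous (w m)) ∧ (∀ m y, w m y ∈ Icc (0 : ℝ) 1) ∧
      (∀ y, ∃ m, w m y = 1) ∧ ∀ m, ∀ y ∉ O m, ∀ᶠ y' in 𝓝 y, w m y' = 0 := by
  have : ParacompactSpace Y := by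
    let _ := TopologicalSpace.metrizableSpaceMetric Y
    infer_instance
  obtain ⟨μ, hμ⟩ := PartitionOfUnity.exists_isSubordinate isClosed_univ O hO hc.ge
  refine ⟨fun m y => min 1 (2 ^ (m + 2) * μ m y), fun m => ?_, fun m y => ⟨?_, min_le_left _ _⟩,
    fun y => ?_, fun m y hy => ?_⟩
  · exact continuous_const.min (continuous_const.mul (μ m).continuous)
  · have := μ.nonneg m y
    exact le_min zero_le_one (by positivity)
  · by_contra! hcon
    have h1 : ∀ m, μ m y ≤ (1 / 2) ^ m / 4 := by
      intro m
      by_contra! hlt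
      refine hcon m (min_eq_left ?_)
      have : (2 : ℝ) ^ (m + 2) * ((1 / 2) ^ m / 4) = 1 := by
        rw [pow_add, one_div, inv_pow]
        field_simp
        norm_num
      rw [← this]
      exact mul_le_mul_of_nonneg_left hlt.le (by positivity)
    have h2 := μ.sum_eq_one (mem_univ y)
    have hfin : {m | y ∈ Function.support (μ m)}.Finite := μ.locallyFinite.point_finite y
    rw [finsum_eq_sum_of_support_subset (s := hfin.toFinset) _ (by
      intro m hm
      simpa using hm)] at h2
    have h3 := Finset.sum_le_sum fun m (_ : m ∈ hfin.toFinset) => h1 m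
    rw [h2, ← Finset.sum_div] at h3
    have h4 := summable_geometric_two.sum_le_tsum hfin.toFinset (fun i _ => by positivity)
    rw [tsum_geometric_two] at h4
    linarith
  · have h1 : y ∉ tsupport (μ m) := fun h => hy (hμ m h)
    rw [notMem_tsupport_iff_eventuallyEq] at h1
    filter_upwards [h1] with y' hy'
    rw [hy']
    simp

lemma good_dense {X Y : Type*} [TopologicalSpace X] [TopologicalSpace.MetrizableSpace X]
    [TopologicalSpace Y] [TopologicalSpace.MetrizableSpace Y] {n : ℕ} {E1 E2 : Type*}
    [NormedAddCommGroup E1] [NormedSpace ℝ E1] [FiniteDimensional ℝ E1] [Nontrivial E1]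
    [NormedAddCommGroup E2] [NormedSpace ℝ E2] [FiniteDimensional ℝ E2]
    (hdim : n < Module.finrank ℝ E1 + Module.finrank ℝ E2) (hY : IsCSpace Y)
    {f : X → Y} (hf : Continuous f) {A : Set X} (hA : IsClosed A)
    (hp : IsProperMap (fun a : A => f a))
    (hd : ∀ y, CovDimLENat (f ⁻¹' {y}) n) (φ : C(X, E1)) {ε : ℝ} (hε : 0 < ε)
    (g : X →ᵇ E2) (α : X → ℝ) (hα : Continuous α) (hα0 : ∀ x, 0 < α x) :
    ∃ h ∈ GoodSet f A φ ε, ∀ x, dist (h x) (g x) ≤ α x := by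
  wlog hα1 : ∀ x, α x ≤ 1 generalizing α
  · obtain ⟨h, hh, hh'⟩ := this (fun x => min 1 (α x)) (continuous_const.min hα)
      (fun x => lt_min one_pos (hα0 x)) (fun x => min_le_left _ _)
    exact ⟨h, hh, fun x => (hh' x).trans (min_le_right _ _)⟩
  have : CompleteSpace E2 := FiniteDimensional.complete ℝ E2
  let η : ℕ → ℝ := fun m => 1 / 4 * (1 / 16) ^ m
  have hη : ∀ m, 0 < η m := fun m => by positivity
  obtain ⟨P, U, d, hP0, hPs, hUo, hUc, hdn, hprop⟩ :=
    stages hdim hA hp hd φ hε g hα hα0 (‖g‖ + 1) η hη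
  obtain ⟨O, idx, hOo, hOc, hidx, hidx'⟩ := cspace_index hY U hUo hUc
  obtain ⟨w, hwc, hw01, hw1, hw0⟩ := cspace_weights O hOo hOc
  let D : ℕ → Y → (X →ᵇ E2) := fun m y => w m y • d m (idx m y)
  have hDn : ∀ m y x, ‖D m y x‖ ≤ 3 * η m := by
    intro m y x
    change ‖w m y • d m (idx m y) x‖ ≤ _
    rw [norm_smul, Real.norm_of_nonneg (hw01 m y).1]
    have h1 := hdn m (idx m y) x
    have h2 := (hw01 m y).2
    have h3 := norm_nonneg (d m (idx m y) x)
    nlinarith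
  have hDc : ∀ m, Continuous fun x => D m (f x) x := by
    intro m
    rw [continuous_iff_continuousAt]
    intro x
    by_cases hx : f x ∈ O m
    · have h1 : Continuous fun x' => w m (f x') • d m (idx m (f x)) x' :=
        ((hwc m).comp hf).smul (d m (idx m (f x))).continuous
      refine h1.continuousAt.congr ?_
      filter_upwards [hf.continuousAt.eventually (hidx' m (f x) hx)] with x' hx'
      change _ = w m (f x') • d m (idx m (f x')) x'
      rw [hx']
    · refine (continuousAt_const (y := (0 : E2))).congr ?_
      filter_upwards [hf.continuousAt.eventually (hw0 m (f x) hx)] with x' hx'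
      change _ = w m (f x') • d m (idx m (f x')) x'
      rw [hx', zero_smul]
  have hgeo : HasSum (fun m : ℕ => ((1 : ℝ) / 16) ^ m) (16 / 15) := by
    have := hasSum_geometric_of_lt_one (r := (1 : ℝ) / 16) (by norm_num) (by norm_num)
    convert this using 1
    norm_num
  have htail : ∀ m, HasSum (fun j => 3 * η (j + m)) (4 / 5 * (1 / 16) ^ m) := by
    intro m
    have := hgeo.mul_left (3 / 4 * (1 / 16) ^ m)
    have e1 : (fun j => 3 * η (j + m)) = fun i => 3 / 4 * (1 / 16) ^ m * (1 / 16) ^ i := by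
      funext j
      simp only [η, pow_add]
      ring
    have e2 : (4 : ℝ) / 5 * (1 / 16) ^ m = 3 / 4 * (1 / 16) ^ m * (16 / 15) := by ring
    rw [e1, e2]
    exact this
  have hsumm : ∀ y x, Summable fun m => D m y x := fun y x =>
    Summable.of_norm_bounded (htail 0).summable (fun m => hDn m y x)
  let Q : X → E2 := fun x => ∑' m, D m (f x) x
  have hQc : Continuous Q := continuous_tsum hDc (htail 0).summable (fun m x => hDn m (f x) x)
  have hQn : ∀ x, ‖Q x‖ ≤ 1 := by
    intro x
    refine (tsum_of_norm_bounded (htail 0) (fun m => hDn m (f x) x)).trans ?_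
    norm_num
  have hαQ : ∀ x, ‖α x • Q x‖ ≤ α x := by
    intro x
    rw [norm_smul, Real.norm_of_nonneg (hα0 x).le]
    exact mul_le_of_le_one_right (hα0 x).le (hQn x)
  let H : X →ᵇ E2 := g + BoundedContinuousFunction.ofNormedAddCommGroup (fun x => α x • Q x)
    (hα.smul hQc) 1 (fun x => (hαQ x).trans (hα1 x))
  have hH : ∀ x, H x = g x + α x • Q x := fun x => rfl
  refine ⟨H, ?_, fun x => ?_⟩
  swap
  · rw [hH, dist_eq_norm, add_sub_cancel_left]
    exact hαQ x
  intro y z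
  by_cases hz : z ∈ closedBall (0 : E2) (‖g‖ + 1)
  swap
  · refine ⟨φ, fun x => by simpa using hε.le, fun x _ _ hx => ?_⟩
    exfalso
    apply hz
    rw [mem_closedBall_zero_iff, ← hx, hH]
    refine (norm_add_le _ _).trans (add_le_add (g.norm_coe_le_norm x) ((hαQ x).trans (hα1 x)))
  obtain ⟨m, hm⟩ := hw1 y
  have hs : ∀ m, ∑ j ∈ Finset.range m, D j y ∈ P m y := by
    intro m
    induction m with
    | zero => simpa using hP0 y
    | succ m ih =>
      rw [Finset.sum_range_succ]
      exact hPs m y (idx m y) _ (w m y) (hw01 m y) ih (hidx m y)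
  obtain ⟨ψ, h1, h2⟩ := hprop m (idx m y) y (hidx m y) _ (hs m) z hz
  refine ⟨ψ, h1, fun x hxA hxy hxz => h2 x hxA hxy ?_⟩
  have hDm : D m y x = d m (idx m y) x := by
    change w m y • d m (idx m y) x = _
    rw [hm, one_smul]
  have hQ : Q x = (∑ j ∈ Finset.range m, D j y) x + d m (idx m y) x +
      ∑' j, D (j + (m + 1)) y x := by
    rw [← hDm]
    simp only [Q, hxy]
    rw [← (hsumm y x).sum_add_tsum_nat_add (m + 1), Finset.sum_range_succ,
      BoundedContinuousFunction.sum_apply]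
  have hz' : (α x)⁻¹ • (g x - z) = - Q x := by
    have : g x - z = - (α x • Q x) := by
      rw [← hxz, hH]; abel
    rw [this, smul_neg, inv_smul_smul₀ (hα0 x).ne']
  have hfin : (α x)⁻¹ • (g x - z) + (∑ j ∈ Finset.range m, D j y) x + d m (idx m y) x =
      - ∑' j, D (j + (m + 1)) y x := by
    rw [hz', hQ]; abel
  rw [hfin, norm_neg]
  refine (tsum_of_norm_bounded (htail (m + 1)) (fun j => hDn _ y x)).trans ?_
  simp only [η, pow_succ]
  have : (0 : ℝ) < (1 / 16) ^ m := by positivity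
  nlinarith

lemma small_cover {X Y : Type*} [MetricSpace X] [TopologicalSpace Y]
    (hY : IsCSpace Y) {f : X → Y} (hf : Continuous f) {A : Set X} (hA : IsClosed A)
    (hp : IsProperMap (fun a : A => f a)) {δ : ℝ} (hδ : 0 < δ) :
    ∃ W : ℕ × ℕ → Set X, (∀ i, IsOpen (W i)) ∧ (∀ x ∈ A, ∃ i, x ∈ W i) ∧
      ∀ i, ∀ a ∈ W i, ∀ b ∈ W i, f a = f b → dist a b < δ := by
  classical
  have hB : ∀ y : Y, ∃ B : ℕ → Set X, (∀ j, IsOpen (B j)) ∧ (A ∩ f ⁻¹' {y} ⊆ ⋃ j, B j) ∧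
      ∀ j, ∀ a ∈ B j, ∀ b ∈ B j, dist a b < δ := by
    intro y
    obtain ⟨s, -, hs⟩ := (proper_fiber_compact hp y).elim_nhds_subcover
      (fun c => ball c (δ / 2)) (fun c _ => ball_mem_nhds c (half_pos hδ))
    have hcount : (insert ∅ ((fun c => ball c (δ / 2)) '' (s : Set X))).Countable :=
      ((s.finite_toSet.image _).insert _).countable
    obtain ⟨B, hB⟩ := hcount.exists_eq_range ⟨∅, mem_insert _ _⟩
    have hmem : ∀ j, B j = ∅ ∨ ∃ c, B j = ball c (δ / 2) := by
      intro j
      have : B j ∈ insert ∅ ((fun c => ball c (δ / 2)) '' (s : Set X)) := hB ▸ mem_range_self j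
      rcases this with h | ⟨c, -, h⟩
      · exact Or.inl h
      · exact Or.inr ⟨c, h.symm⟩
    refine ⟨B, fun j => ?_, fun x hx => ?_, fun j a ha b hb => ?_⟩
    · rcases hmem j with h | ⟨c, h⟩
      · rw [h]; exact isOpen_empty
      · rw [h]; exact isOpen_ball
    · obtain ⟨c, hc, hxc⟩ := mem_iUnion₂.1 (hs hx)
      have : ball c (δ / 2) ∈ range B := hB ▸ Or.inr ⟨c, hc, rfl⟩
      obtain ⟨j, hj⟩ := this
      exact mem_iUnion.2 ⟨j, hj ▸ hxc⟩
    · rcases hmem j with h | ⟨c, h⟩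
      · rw [h] at ha; exact ha.elim
      · rw [h, mem_ball] at ha hb
        have := dist_triangle_right a b c
        linarith
  choose B hBo hBc hBd using hB
  let U : Y → Set Y := fun y => (f '' (A \ ⋃ j, B y j))ᶜ
  have hUo : ∀ y, IsOpen (U y) := fun y =>
    (proper_image_closed hp (hA.sdiff (isOpen_iUnion (hBo y))) sdiff_subset).isOpen_compl
  have hUy : ∀ y, y ∈ U y := by
    rintro y ⟨x, ⟨hxA, hx⟩, hxy⟩
    exact hx (hBc y ⟨hxA, hxy⟩)
  obtain ⟨O, idx, hOo, hOc, hidx, hidx'⟩ := cspace_index hY (fun _ => U) (fun _ => hUo)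
    (fun _ => univ_subset_iff.1 fun y _ => mem_iUnion.2 ⟨y, hUy y⟩)
  refine ⟨fun p => {x | f x ∈ O p.1 ∧ x ∈ B (idx p.1 (f x)) p.2}, ?_, ?_, ?_⟩
  · rintro ⟨m, j⟩
    rw [isOpen_iff_mem_nhds]
    rintro x ⟨hx1, hx2⟩
    filter_upwards [hf.continuousAt.eventually (hidx' m (f x) hx1),
      ((hOo m).preimage hf).mem_nhds hx1, (hBo _ j).mem_nhds hx2] with x' h1 h2 h3
    refine ⟨h2, ?_⟩
    rw [h1]
    exact h3
  · intro x hx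
    obtain ⟨m, hm⟩ := mem_iUnion.1 (hOc.ge (mem_univ (f x)))
    have h1 : x ∈ ⋃ j, B (idx m (f x)) j := by
      by_contra hcon
      exact hidx m (f x) ⟨x, ⟨hx, hcon⟩, rfl⟩
    obtain ⟨j, hj⟩ := mem_iUnion.1 h1
    exact ⟨(m, j), hm, hj⟩
  · rintro ⟨m, j⟩ a ⟨-, ha⟩ b ⟨-, hb⟩ hab
    rw [← hab] at hb
    exact hBd _ j a ha b hb

lemma countable_base {X Y : Type*} [TopologicalSpace X] [TopologicalSpace.MetrizableSpace X]
    [TopologicalSpace Y]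
    (hY : IsCSpace Y) {f : X → Y} (hf : Continuous f) {A : Set X} (hA : IsClosed A)
    (hp : IsProperMap (fun a : A => f a)) :
    ∃ W : ℕ × ℕ × ℕ → Set X, (∀ i, IsOpen (W i)) ∧
      ∀ x ∈ A, ∀ N ∈ 𝓝 x, ∃ i, x ∈ W i ∧ f ⁻¹' {f x} ∩ W i ⊆ N := by
  let _ := TopologicalSpace.metrizableSpaceMetric X
  choose W hWo hWc hWd using fun t : ℕ => small_cover hY hf hA hp
    (δ := 1 / ((t : ℝ) + 1)) (by positivity)
  refine ⟨fun p => W p.1 p.2, fun p => hWo _ _, fun x hx N hN => ?_⟩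
  obtain ⟨δ, hδ, hδN⟩ := Metric.mem_nhds_iff.1 hN
  obtain ⟨t, ht⟩ := exists_nat_one_div_lt hδ
  obtain ⟨i, hi⟩ := hWc t x hx
  refine ⟨(t, i), hi, ?_⟩
  rintro x' ⟨h1, h2⟩
  exact hδN (mem_ball.2 ((hWd t i x' h2 x hi h1).trans ht))

/-- Difference map attached to a tuple of functions. -/
def diffMap {X : Type*} [TopologicalSpace X] {p : ℕ} (κ : Fin (p + 2) → C(X, ℝ)) :
    C(X, Fin (p + 1) → ℝ) :=
  ⟨fun x i => κ i.succ x - κ 0 x, by fun_prop⟩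

lemma fiber_shrink {X Y E2 : Type*} [TopologicalSpace X] [TopologicalSpace.MetrizableSpace X]
    [TopologicalSpace Y] [TopologicalSpace.MetrizableSpace Y] [NormedAddCommGroup E2]
    {f : X → Y} {A : Set X} (hA : IsClosed A) (hp : IsProperMap (fun a : A => f a)) {p : ℕ}
    {I : Type*} (W : I → Set X) (hWo : ∀ i, IsOpen (W i))
    (hW : ∀ x ∈ A, ∀ N ∈ 𝓝 x, ∃ i, x ∈ W i ∧ f ⁻¹' {f x} ∩ W i ⊆ N)
    (κ : Finset I → C(X, ℝ)) (hκ0 : ∀ s x, 0 ≤ κ s x)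
    (hκ : ∀ s x, κ s x ≠ 0 ↔ ∃ i ∈ s, x ∈ W i)
    (g : X →ᵇ E2) (hg : ∀ (τ : Fin (p + 2) → Finset I) (l : ℕ),
      g ∈ GoodSet f A (diffMap fun j => κ (τ j)) (1 / ((l : ℝ) + 1)))
    (y : Y) (z : E2)
    (U : Fin (p + 2) → Set ((fun x => (f x, g x)) ⁻¹' {(y, z)})) (hU : ∀ j, IsOpen (U j))
    (hc : ⋃ j, U j = univ) :
    ∃ V : Fin (p + 2) → Set ((fun x => (f x, g x)) ⁻¹' {(y, z)}), (∀ j, IsOpen (V j)) ∧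
      (∀ j, V j ⊆ U j) ∧ ⋃ j, V j = univ ∧ (Subtype.val ⁻¹' A) ∩ ⋂ j, V j = ∅ := by
  classical
  choose N hNo hNU using fun j => isOpen_induced_iff.1 (hU j)
  have hfib : ∀ x, x ∈ (fun x => (f x, g x)) ⁻¹' {(y, z)} ↔ f x = y ∧ g x = z := by
    intro x; simp
  let K : Set X := (A ∩ f ⁻¹' {y}) ∩ g ⁻¹' {z}
  have hK : IsCompact K :=
    (proper_fiber_compact hp y).inter_right (isClosed_singleton.preimage g.continuous)
  let I' := {i : I // ∃ j, f ⁻¹' {y} ∩ W i ⊆ N j}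
  have hKc : K ⊆ ⋃ i : I', W i.1 := by
    rintro x ⟨⟨hxA, hxy⟩, hxz⟩
    have hx : x ∈ (fun x => (f x, g x)) ⁻¹' {(y, z)} := (hfib x).2 ⟨hxy, hxz⟩
    obtain ⟨j, hj⟩ := mem_iUnion.1 (hc.ge (mem_univ ⟨x, hx⟩))
    rw [← hNU j] at hj
    obtain ⟨i, hi1, hi2⟩ := hW x hxA (N j) ((hNo j).mem_nhds hj)
    rw [show f x = y from hxy] at hi2
    exact mem_iUnion.2 ⟨⟨i, j, hi2⟩, hi1⟩
  obtain ⟨t, ht⟩ := hK.elim_finite_subcover _ (fun i : I' => hWo i.1) hKc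
  let jj : I' → Fin (p + 2) := fun i => i.2.choose
  have hjj : ∀ i : I', f ⁻¹' {y} ∩ W i.1 ⊆ N (jj i) := fun i => i.2.choose_spec
  let τ : Fin (p + 2) → Finset I := fun j => (t.filter fun i => jj i = j).image Subtype.val
  have hτN : ∀ j x, f x = y → κ (τ j) x ≠ 0 → x ∈ N j := by
    intro j x hx h
    obtain ⟨i, hi, hxi⟩ := (hκ _ _).1 h
    obtain ⟨i', hi', rfl⟩ := Finset.mem_image.1 hi
    obtain ⟨-, rfl⟩ := Finset.mem_filter.1 hi'
    exact hjj i' ⟨hx, hxi⟩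
  have hτK : ∀ x ∈ K, ∃ j, 0 < κ (τ j) x := by
    intro x hx
    obtain ⟨i, hi, hxi⟩ := mem_iUnion₂.1 (ht hx)
    refine ⟨jj i, lt_of_le_of_ne (hκ0 _ _) (Ne.symm ((hκ _ _).2 ⟨i.1, ?_, hxi⟩))⟩
    exact Finset.mem_image.2 ⟨i, Finset.mem_filter.2 ⟨hi, rfl⟩, rfl⟩
  obtain ⟨l, hl⟩ := hK.elim_directed_cover
    (fun l : ℕ => ⋃ j, {x | 4 * (1 / ((l : ℝ) + 1)) < κ (τ j) x})
    (fun l => isOpen_iUnion fun j => isOpen_lt continuous_const (κ (τ j)).continuous)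
    (by
      intro x hx
      obtain ⟨j, hj⟩ := hτK x hx
      obtain ⟨l, hl⟩ := exists_nat_one_div_lt (show 0 < κ (τ j) x / 4 by positivity)
      refine mem_iUnion.2 ⟨l, mem_iUnion.2 ⟨j, ?_⟩⟩
      change 4 * (1 / ((l : ℝ) + 1)) < κ (τ j) x
      linarith)
    (by
      refine Monotone.directed_le ?_
      intro a b hab
      refine iUnion_mono fun j x hx => ?_
      change 4 * (1 / ((a : ℝ) + 1)) < κ (τ j) x at hx
      change 4 * (1 / ((b : ℝ) + 1)) < κ (τ j) x
      have := one_div_le_one_div_of_le (show (0 : ℝ) < (a : ℝ) + 1 by positivity)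
        (show (a : ℝ) + 1 ≤ (b : ℝ) + 1 by
          have : (a : ℝ) ≤ b := by exact_mod_cast hab
          linarith)
      linarith)
  obtain ⟨ε, hε⟩ : ∃ ε : ℝ, ε = 1 / ((l : ℝ) + 1) := ⟨_, rfl⟩
  have hε0 : 0 < ε := by rw [hε]; positivity
  obtain ⟨ψ, hψ1, hψ2⟩ := hg τ l y z
  simp only [← hε] at hl hψ1
  let κ' : Fin (p + 2) → X → ℝ := fun j x =>
    κ (τ 0) x + (Fin.cons (0 : ℝ) (ψ x) : Fin (p + 2) → ℝ) j
  have hκ'0 : ∀ x, κ' 0 x = κ (τ 0) x := fun x => by simp [κ']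
  have hκ's : ∀ i x, κ' (Fin.succ i) x = κ (τ 0) x + ψ x i := fun i x => by simp [κ']
  have hκ'c : ∀ j, Continuous (κ' j) := by
    intro j
    refine Fin.cases ?_ (fun i => ?_) j
    · rw [show κ' 0 = fun x => κ (τ 0) x from funext hκ'0]
      exact (κ (τ 0)).continuous
    · rw [show κ' i.succ = fun x => κ (τ 0) x + ψ x i from funext (hκ's i)]
      fun_prop
  have hclose : ∀ j x, |κ' j x - κ (τ j) x| ≤ ε := by
    intro j x
    refine Fin.cases ?_ (fun i => ?_) j
    · rw [hκ'0]; simpa using hε0.le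
    · rw [hκ's]
      have h1 := (norm_le_pi_norm (ψ x - diffMap (fun j => κ (τ j)) x) i).trans (hψ1 x)
      have h2 : (ψ x - diffMap (fun j => κ (τ j)) x) i =
          ψ x i - (κ (τ i.succ) x - κ (τ 0) x) := rfl
      rw [h2, Real.norm_eq_abs] at h1
      rw [show κ (τ 0) x + ψ x i - κ (τ i.succ) x = ψ x i - (κ (τ i.succ) x - κ (τ 0) x) by ring]
      exact h1
  let G : Fin (p + 2) → Set X := fun j => {x | ε < κ' j x} ∩ ⋃ l, {x | κ' l x < κ' j x}
  have hGo : ∀ j, IsOpen (G j) := fun j => (isOpen_lt continuous_const (hκ'c j)).inter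
    (isOpen_iUnion fun l => isOpen_lt (hκ'c l) (hκ'c j))
  refine ⟨fun j => U j ∩ (Subtype.val ⁻¹' (Aᶜ ∪ G j)), fun j => (hU j).inter
    ((hA.isOpen_compl.union (hGo j)).preimage continuous_subtype_val),
    fun j => inter_subset_left, ?_, ?_⟩
  · rw [← univ_subset_iff]
    rintro ⟨x, hx⟩ -
    obtain ⟨hxy, hxz⟩ := (hfib x).1 hx
    by_cases hxA : x ∈ A
    · have hxK : x ∈ K := ⟨⟨hxA, hxy⟩, hxz⟩
      obtain ⟨j0, hj0⟩ := mem_iUnion.1 (hl hxK)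
      change 4 * ε < κ (τ j0) x at hj0
      obtain ⟨j, hj⟩ := Finite.exists_max fun j => κ' j x
      have h1 : 3 * ε < κ' j x := by
        have a1 := (abs_le.1 (hclose j0 x)).1
        have a2 := hj j0
        linarith
      have h2 : ∃ l, κ' l x < κ' j x := by
        by_contra! hcon
        apply hψ2 x hxA hxy hxz
        have heq : ∀ l, κ' l x = κ' j x := fun l => le_antisymm (hj l) (hcon l)
        funext i
        have a1 := (heq i.succ).trans (heq 0).symm
        rw [hκ's, hκ'0] at a1
        change ψ x i = 0
        linarith
      have h3 : κ (τ j) x ≠ 0 := by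
        have a1 := (abs_le.1 (hclose j x)).2
        have : 0 < κ (τ j) x := by linarith
        exact this.ne'
      refine mem_iUnion.2 ⟨j, ?_, Or.inr ⟨?_, mem_iUnion.2 h2⟩⟩
      · rw [← hNU j]
        exact hτN j x hxy h3
      · change ε < κ' j x
        linarith
    · obtain ⟨j, hj⟩ := mem_iUnion.1 (hc.ge (mem_univ ⟨x, hx⟩))
      exact mem_iUnion.2 ⟨j, hj, Or.inl hxA⟩
  · rw [← subset_empty_iff]
    rintro x ⟨hxA, hx⟩
    obtain ⟨j, hj⟩ := Finite.exists_min fun j => κ' j x.1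
    rcases (mem_iInter.1 hx j).2 with h | h
    · exact h hxA
    · obtain ⟨l, hl⟩ := mem_iUnion.1 h.2
      exact absurd (hj l) (not_le.2 hl)

lemma covDimLE_nat {T : Type*} [TopologicalSpace T] {n : ℕ} (h : CovDimLE T n) :
    CovDimLENat T n := by
  rcases h with h | ⟨k, hk, h⟩
  · intro 𝒰 _ _ _
    exact ⟨∅, by simp, Subsingleton.elim _ _, by simp, fun x => h.elim x⟩
  · intro 𝒰 h1 h2 h3
    obtain ⟨𝒱, a1, a2, a3, a4⟩ := h 𝒰 h1 h2 h3
    refine ⟨𝒱, a1, a2, a3, fun x => ⟨(a4 x).1, (a4 x).2.trans ?_⟩⟩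
    have : k ≤ n := by exact_mod_cast hk
    omega

lemma proper_of_perfect {X Y : Type*} [TopologicalSpace X] [TopologicalSpace Y] {f : X → Y}
    {A : Set X} (hc : IsClosed (f '' A))
    (hp : IsPerfectMap (Set.MapsTo.restrict f A (f '' A) (Set.mapsTo_image f A))) :
    IsProperMap (fun a : A => f a) := by
  have h1 : IsProperMap (Set.MapsTo.restrict f A (f '' A) (Set.mapsTo_image f A)) :=
    isProperMap_iff_isClosedMap_and_compact_fibers.2 ⟨hp.1, hp.2.1, hp.2.2⟩
  exact (hc.isClosedEmbedding_subtypeVal.isProperMap).comp h1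

/-- (Theorem 4.1) For a σ-perfect `n`-dimensional map `f : X → Y` with
`Y` a C-space and `0 ≤ k ≤ n`, almost all bounded maps `g : X → ℝ^k` are such that
`f × g` is `(n - k)`-dimensional. -/
theorem statement9 {X Y : Type*} [TopologicalSpace X] [TopologicalSpace.MetrizableSpace X]
    [TopologicalSpace Y] [TopologicalSpace.MetrizableSpace Y]
    (n k : ℕ) (hk : k ≤ n) (f : X → Y) (hf : IsSigmaPerfectMap f)
    (hfdim : DimMapLE f n) (hY : IsCSpace Y) :
    ∃ G : Set (X →ᵇ EuclideanSpace ℝ (Fin k)),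
      @Dense _ (sourceLimitation X (EuclideanSpace ℝ (Fin k))) G ∧
      @IsGδ _ (sourceLimitation X (EuclideanSpace ℝ (Fin k))) G ∧
      ∀ g ∈ G, ∀ z : Y × EuclideanSpace ℝ (Fin k),
        CovDimLE ((fun x => (f x, g x)) ⁻¹' {z}) ((n : ℤ) - k) := by
  classical
  obtain ⟨hfc, A, hAu, hA⟩ := hf
  obtain ⟨p, rfl⟩ := Nat.exists_eq_add_of_le hk
  have hp : ∀ i, IsProperMap (fun a : A i => f a) := fun i =>
    proper_of_perfect (hA i).2.1 (hA i).2.2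
  have hd : ∀ y, CovDimLENat (f ⁻¹' {y}) (k + p) := fun y => covDimLE_nat (hfdim y)
  choose W hWo hW using fun i => countable_base hY hfc (hA i).1 (hp i)
  have hκ : ∀ i (s : Finset (ℕ × ℕ × ℕ)), ∃ κ : C(X, ℝ), (∀ x, 0 ≤ κ x) ∧
      ∀ x, κ x ≠ 0 ↔ ∃ j ∈ s, x ∈ W i j := by
    intro i s
    obtain ⟨κ, h1, h2⟩ := exists_zero_fun (C := (⋃ j ∈ s, W i j)ᶜ)
      (isOpen_biUnion fun j _ => hWo i j).isClosed_compl
    refine ⟨κ, h2, fun x => ?_⟩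
    rw [Ne, h1]
    simp
  choose κ hκ0 hκ using hκ
  obtain ⟨e, he⟩ := exists_surjective_nat
    (ℕ × (Fin (p + 2) → Finset (ℕ × ℕ × ℕ)) × ℕ)
  let O : ℕ → Set (X →ᵇ EuclideanSpace ℝ (Fin k)) := fun m =>
    GoodSet f (A (e m).1) (diffMap fun j => κ (e m).1 ((e m).2.1 j)) (1 / (((e m).2.2 : ℝ) + 1))
  have hOo : ∀ m, ∀ g ∈ O m, ∃ α : X → ℝ, Continuous α ∧ (∀ x, 0 < α x) ∧
      ∀ h : X →ᵇ EuclideanSpace ℝ (Fin k), (∀ x, dist (h x) (g x) ≤ α x) → h ∈ O m :=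
    fun m g hg => good_open hfc (hA _).1 (hp _) _ (by positivity) g hg
  have hOd : ∀ m, ∀ (g : X →ᵇ EuclideanSpace ℝ (Fin k)) (α : X → ℝ), Continuous α →
      (∀ x, 0 < α x) → ∃ h ∈ O m, ∀ x, dist (h x) (g x) ≤ α x :=
    fun m g α hα hα0 => good_dense (n := k + p) (by simp; omega) hY hfc (hA _).1 (hp _) hd _
      (by positivity) g α hα hα0
  refine ⟨⋂ m, O m, source_dense_of (source_baire O hOo hOd), ?_, ?_⟩
  · exact @IsGδ.iInter_of_isOpen _ _ (sourceLimitation X (EuclideanSpace ℝ (Fin k))) _ O hOo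
  · rintro g hg ⟨y, z⟩
    refine Or.inr ⟨p, by push_cast; omega, hemmingsen ?_⟩
    refine countable_sum (fun i => Subtype.val ⁻¹' A i) ?_ ?_
    · rw [← preimage_iUnion, hAu, preimage_univ]
    · intro i U hU hc
      refine fiber_shrink (hA i).1 (hp i) (W i) (hWo i) (hW i) (κ i) (hκ0 i) (hκ i) g ?_ y z U hU hc
      intro τ l
      obtain ⟨m, hm⟩ := he (i, τ, l)
      have := mem_iInter.1 hg m
      simp only [O, hm] at this
      exact this
end

section
/- Let f : X → Y be a perfect n-dimensional surjective map between metrizable spaces, 0 ≤ k ≤ n, and for ε > 0 and y ∈ Y let 𝒞_ε(y) be the set of all g ∈ C*(X, ℝ^k) such that every set f⁻¹(y) ∩ g⁻¹(z), z ∈ ℝ^k, can be covered by a finite family γ of open subsets of X, each of diameter ≤ ε, such that every point of X is contained in at most n − k + 1 elements of γ. Then for any ε > 0, m ≥ 1 and y ∈ Y, the set of all maps g ∈ C(𝕀^m × f⁻¹(y), ℝ^k) such that g|({z} × f⁻¹(y)) ∈ 𝒞_ε(y) for each z ∈ 𝕀^m is dense in C(𝕀^m × f⁻¹(y), ℝ^k)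 with respect to the uniform convergence topology. -/
open Set Topology Metric BoundedContinuousFunction

/-- A degenerate position: `p v` is an affine combination of fewer than `k + 1` other points. -/
def BadPos (k : ℕ) {ι E : Type*} [AddCommGroup E] [Module ℝ E] (p : ι → E) (v s : ι)
    (T : Finset ι) : Prop :=
  s ≠ v ∧ v ∉ T ∧ T.card + 1 ≤ k ∧ ∃ l : ι → ℝ, p v = p s + ∑ i ∈ T, l i • (p i - p s)

lemma badPos_of_rel {k : ℕ} {ι E : Type*} [AddCommGroup E] [Module ℝ E]
    (p : ι → E) (S : Finset ι) (hS : S.card ≤ k + 1) (μ : ι → ℝ)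
    (h0 : ∑ i ∈ S, μ i = 0) (h1 : ∑ i ∈ S, μ i • p i = 0) (v : ι) (hv : v ∈ S) (hμ : μ v ≠ 0) :
    ∃ s T, BadPos k p v s T := by
  classical
  have h2 : ∃ s ∈ S.erase v, μ s ≠ 0 := by
    by_contra! hcon
    rw [← Finset.add_sum_erase S μ hv, Finset.sum_eq_zero hcon] at h0
    exact hμ (by simpa using h0)
  obtain ⟨s, hs, -⟩ := h2
  have hsv := Finset.ne_of_mem_erase hs
  have hsS := Finset.mem_of_mem_erase hs
  refine ⟨s, (S.erase v).erase s, hsv, by simp, ?_, fun i => - μ i / μ v, ?_⟩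
  · have e1 := Finset.card_erase_add_one hs
    have e2 := Finset.card_erase_add_one hv
    omega
  · have h3 : ∑ i ∈ S, μ i • (p i - p s) = 0 := by
      simp only [smul_sub, Finset.sum_sub_distrib, h1, ← Finset.sum_smul, h0]; simp
    rw [← Finset.add_sum_erase S _ hv, ← Finset.add_sum_erase (S.erase v) _ hs] at h3
    simp only [sub_self, smul_zero, zero_add] at h3
    have h4 : ∑ i ∈ (S.erase v).erase s, (- μ i / μ v) • (p i - p s)
        = - ((μ v)⁻¹ • ∑ i ∈ (S.erase v).erase s, μ i • (p i - p s)) := by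
      rw [Finset.smul_sum, ← Finset.sum_neg_distrib]
      refine Finset.sum_congr rfl fun i _ => ?_
      rw [smul_smul, ← neg_smul]; congr 1; field_simp
    rw [h4, eq_neg_of_add_eq_zero_right h3, smul_neg, smul_smul, inv_mul_cancel₀ hμ]
    simp

/-- triangular systems of positions -/
def TriPos {q : ℕ} {ι : Type*} (v s : Fin q → ι) (T : Fin q → Finset ι) : Prop :=
  Function.Injective v ∧ ∀ i j, j ≤ i → s j ≠ v i ∧ v i ∉ T j

lemma exists_small_W {k m : ℕ} {ι E : Type*} [AddCommGroup E] [Module ℝ E]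
    (p : ι → E)
    (hp : ¬ ∃ (v s : Fin (m + 1) → ι) (T : Fin (m + 1) → Finset ι), TriPos v s T ∧
      ∀ i, BadPos k p (v i) (s i) (T i)) :
    ∃ W : Finset ι, W.card ≤ m * (k + 1) ∧ ∀ v ∉ W, ∀ s T, ¬ BadPos k p v s T := by
  classical
  by_contra! hcon
  apply hp
  have hcon' : ∀ W : Finset ι, ∃ v s T, W.card ≤ m * (k + 1) → v ∉ W ∧ BadPos k p v s T := by
    intro W
    obtain ⟨v0, -⟩ := hcon ∅ (by simp)
    by_cases h : W.card ≤ m * (k + 1)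
    · obtain ⟨v, h1, s, T, h2⟩ := hcon W h
      exact ⟨v, s, T, fun _ => ⟨h1, h2⟩⟩
    · exact ⟨v0, v0, ∅, fun h' => absurd h' h⟩
  choose v s T hvst using hcon'
  let Ws : ℕ → Finset ι := fun j => Nat.rec ∅ (fun _ W => W ∪ insert (v W) (insert (s W) (T W))) j
  have hWs : ∀ j, Ws (j + 1) = Ws j ∪ insert (v (Ws j)) (insert (s (Ws j)) (T (Ws j))) :=
    fun j => rfl
  have hmono : Monotone Ws := monotone_nat_of_le_succ fun j => by
    rw [hWs]; exact Finset.subset_union_left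
  have hcard : ∀ j, j ≤ m + 1 → (Ws j).card ≤ j * (k + 1) := by
    intro j
    induction j with
    | zero => intro _; simp [Ws]
    | succ j ih =>
      intro hj
      have h1 := ih (by omega)
      have h2 : (Ws j).card ≤ m * (k + 1) := h1.trans (Nat.mul_le_mul_right _ (by omega))
      obtain ⟨-, -, -, h3, -⟩ := hvst _ h2
      rw [hWs]
      refine (Finset.card_union_le _ _).trans ?_
      have h4 := Finset.card_insert_le (v (Ws j)) (insert (s (Ws j)) (T (Ws j)))
      have h5 := Finset.card_insert_le (s (Ws j)) (T (Ws j))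
      have : (j + 1) * (k + 1) = j * (k + 1) + (k + 1) := by ring
      omega
  have hgood : ∀ j, j ≤ m → v (Ws j) ∉ Ws j ∧ BadPos k p (v (Ws j)) (s (Ws j)) (T (Ws j)) :=
    fun j hj => hvst _ ((hcard j (by omega)).trans (Nat.mul_le_mul_right _ hj))
  have hin : ∀ i j, i < j → insert (v (Ws i)) (insert (s (Ws i)) (T (Ws i))) ⊆ Ws j := by
    intro i j hij
    refine Finset.Subset.trans ?_ (hmono (Nat.succ_le_of_lt hij))
    rw [Nat.succ_eq_add_one, hWs]; exact Finset.subset_union_right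
  have hne : ∀ i j, i < j → j ≤ m → v (Ws i) ≠ v (Ws j) := by
    intro i j hij hj he
    refine (hgood j hj).1 (he ▸ hin i j hij (by simp))
  refine ⟨fun i => v (Ws i), fun i => s (Ws i), fun i => T (Ws i), ⟨?_, ?_⟩, ?_⟩
  · intro i j hij
    rcases lt_trichotomy i j with h | h | h
    · exact absurd hij (hne i j h (by omega))
    · exact h
    · exact absurd hij.symm (hne j i h (by omega))
  · intro i j hji
    rcases hji.lt_or_eq with h | h
    · have h1 := (hgood i (by omega)).1
      have h2 := hin j i h
      refine ⟨fun he => h1 (h2 (by simp [← show s (Ws j) = v (Ws i) from he])), fun he => h1 (h2 (by simp [he]))⟩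
    · subst h
      obtain ⟨-, h1, h2, -⟩ := hgood j (by omega)
      exact ⟨h1, h2⟩
  · intro i
    exact (hgood i (by omega)).2

lemma param_tri {q : ℕ} {ι E : Type*} [Fintype ι] [DecidableEq ι] [NormedAddCommGroup E] [NormedSpace ℝ E]
    [FiniteDimensional ℝ E] (v s : Fin q → ι) (T : Fin q → Finset ι) (hT : TriPos v s T) :
    ∃ Ψ : ((Σ i : Fin q, {t // t ∈ T i}) → ℝ) × ({u // u ∉ Finset.univ.image v} → E) → (ι → E),
      ContDiff ℝ 1 Ψ ∧ ∀ p : ι → E,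
        (∀ i, ∃ l : ι → ℝ, p (v i) = p (s i) + ∑ t ∈ T i, l t • (p t - p (s i))) →
        p ∈ Set.range Ψ := by
  classical
  have key : ∀ j, j ≤ q →
      ∃ Ψ : ((Σ i : Fin q, {t // t ∈ T i}) → ℝ) × ({u // u ∉ Finset.univ.image v} → E) → (ι → E),
      ContDiff ℝ 1 Ψ ∧ ∀ (p : ι → E) (l : Fin q → ι → ℝ),
        (∀ i, p (v i) = p (s i) + ∑ t ∈ T i, l i t • (p t - p (s i))) →
        ∀ u, (∀ i : Fin q, j ≤ i → u ≠ v i) →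
          Ψ (fun x => l x.1 x.2.1, fun x => p x.1) u = p u := by
    intro j
    induction j with
    | zero =>
      intro _
      refine ⟨fun x u => if h : u ∉ Finset.univ.image v then x.2 ⟨u, h⟩ else 0, ?_, ?_⟩
      · rw [contDiff_pi]
        intro u
        by_cases h : u ∉ Finset.univ.image v
        · simp only [h, not_false_eq_true, dite_true]; fun_prop
        · simp only [h, dite_false]; fun_prop
      · intro p l _ u hu
        have h : u ∉ Finset.univ.image v := by
          intro h'
          obtain ⟨i, -, rfl⟩ := Finset.mem_image.1 h'
          exact hu i (Nat.zero_le _) rfl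
        simp only [h, not_false_eq_true, dite_true]
    | succ j ih =>
      intro hj
      obtain ⟨Ψ, hΨ, hΨ2⟩ := ih (by omega)
      let j' : Fin q := ⟨j, by omega⟩
      refine ⟨fun x => Function.update (Ψ x) (v j') (Ψ x (s j') +
        ∑ t ∈ (T j').attach, x.1 ⟨j', t⟩ • (Ψ x t.1 - Ψ x (s j'))), ?_, ?_⟩
      · have hΨu : ∀ u, ContDiff ℝ 1 fun x => Ψ x u := contDiff_pi.1 hΨ
        rw [contDiff_pi]
        intro u
        by_cases h : u = v j'
        · subst h
          simp only [Function.update_self]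
          refine (hΨu _).add (ContDiff.sum fun t _ => ContDiff.smul ?_ ((hΨu _).sub (hΨu _)))
          fun_prop
        · simp only [Function.update_of_ne h]
          exact hΨu u
      · intro p l hl u hu
        by_cases h : u = v j'
        · subst h
          simp only [Function.update_self]
          rw [hl j', hΨ2 p l hl (s j') (fun i hi => (hT.2 i j' hi).1),
            ← Finset.sum_attach (T j')]
          congr 1
          refine Finset.sum_congr rfl fun t _ => ?_
          rw [hΨ2 p l hl t.1 (fun i hi he => (hT.2 i j' hi).2 (he ▸ t.2))]
        · simp only [Function.update_of_ne h]
          refine hΨ2 p l hl u fun i hi => ?_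
          rcases Nat.lt_or_ge j i with h' | h'
          · exact hu i h'
          · have : i = j' := Fin.ext (le_antisymm h' hi)
            rw [this]; exact h
  obtain ⟨Ψ, h1, h2⟩ := key q le_rfl
  refine ⟨Ψ, h1, fun p hp => ?_⟩
  choose l hl using hp
  exact ⟨_, funext fun u => h2 p l hl u fun i hi => absurd i.2 (not_lt.2 hi)⟩

lemma exists_generic {k m : ℕ} {ι : Type*} [Fintype ι]
    (a : (Fin m → ℝ) → ι → EuclideanSpace ℝ (Fin k)) (ha : ContDiff ℝ 1 a) {η : ℝ} (hη : 0 < η) :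
    ∃ c : ι → EuclideanSpace ℝ (Fin k), ‖c‖ < η ∧ ∀ z,
      ¬ ∃ (v s : Fin (m + 1) → ι) (T : Fin (m + 1) → Finset ι), TriPos v s T ∧
      ∀ i, BadPos k (a z + c) (v i) (s i) (T i) := by
  classical
  rcases Nat.eq_zero_or_pos k with rfl | hk
  · refine ⟨0, by simpa using hη, ?_⟩
    rintro z ⟨v, s, T, -, h⟩
    obtain ⟨-, -, h, -⟩ := h 0
    omega
  rcases isEmpty_or_nonempty ι with hι | hι
  · refine ⟨0, by simpa using hη, ?_⟩
    rintro z ⟨v, -⟩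
    exact hι.elim (v 0)
  let Data := (Fin (m + 1) → ι) × (Fin (m + 1) → ι) × (Fin (m + 1) → Finset ι)
  let D : Data → Set (ι → EuclideanSpace ℝ (Fin k)) := fun d =>
    {c | TriPos d.1 d.2.1 d.2.2 ∧ ∃ z, ∀ i, BadPos k (a z + c) (d.1 i) (d.2.1 i) (d.2.2 i)}
  have hF : Module.finrank ℝ (ι → EuclideanSpace ℝ (Fin k)) = Fintype.card ι * k := by
    rw [Module.finrank_pi_fintype]; simp
  have hpos : 0 < Fintype.card ι * k := Nat.mul_pos Fintype.card_pos hk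
  have hD : ∀ d, dimH (D d) ≤ ((Fintype.card ι * k - 1 : ℕ) : ENNReal) := by
    rintro ⟨v, s, T⟩
    by_cases hne : (D (v, s, T)).Nonempty
    · obtain ⟨c0, hT, z0, hz0⟩ := hne
      simp only at hT hz0
      obtain ⟨Ψ, h1, h2⟩ := param_tri (E := EuclideanSpace ℝ (Fin k)) v s T hT
      let Φ : (Fin m → ℝ) × (((Σ i : Fin (m + 1), {t // t ∈ T i}) → ℝ) ×
        ({u // u ∉ Finset.univ.image v} → EuclideanSpace ℝ (Fin k))) → (ι → EuclideanSpace ℝ (Fin k)) :=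
        fun x => Ψ x.2 - a x.1
      have hΦ : ContDiff ℝ 1 Φ := (h1.comp contDiff_snd).sub (ha.comp contDiff_fst)
      have hsub : D (v, s, T) ⊆ Set.range Φ := by
        rintro c ⟨-, z, hz⟩
        obtain ⟨x, hx⟩ := h2 (a z + c) (fun i => (hz i).2.2.2)
        exact ⟨(z, x), by simp [Φ, hx]⟩
      refine (dimH_mono hsub).trans (hΦ.dimH_range_le.trans ?_)
      norm_cast
      rw [Module.finrank_prod, Module.finrank_prod, Module.finrank_pi_fintype,
        Module.finrank_pi_fintype, Module.finrank_pi_fintype]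
      simp only [Module.finrank_self, Finset.sum_const, Finset.card_univ, Fintype.card_fin,
        smul_eq_mul, mul_one, Fintype.card_sigma, Fintype.card_coe, finrank_euclideanSpace]
      have e1 : Fintype.card {u // u ∉ Finset.univ.image v} = Fintype.card ι - (m + 1) := by
        rw [Fintype.card_subtype_compl]
        rw [Fintype.card_coe, Finset.card_image_of_injective _ hT.1]
        simp
      have e2 : ∑ i, (T i).card ≤ (m + 1) * (k - 1) := by
        refine (Finset.sum_le_card_nsmul _ _ (k - 1) fun i _ => ?_).trans (by simp)
        have := (hz0 i).2.2.1
        omega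
      have e3 : m + 1 ≤ Fintype.card ι := by
        simpa using Fintype.card_le_of_injective v hT.1
      rw [e1]
      obtain ⟨r, hr⟩ := Nat.exists_eq_add_of_le e3
      obtain ⟨k', rfl⟩ : ∃ k', k = 1 + k' := ⟨k - 1, by omega⟩
      rw [hr]
      have e4 : m + 1 + r - (m + 1) = r := by omega
      have e5 : 1 + k' - 1 = k' := by omega
      rw [e4]; rw [e5] at e2
      have : (m + 1 + r) * (1 + k') = m + (m + 1) * k' + r * (1 + k') + 1 := by ring
      omega
    · rw [Set.not_nonempty_iff_eq_empty.1 hne, dimH_empty]; exact zero_le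
  have hdim : dimH (⋃ d, D d) < Module.finrank ℝ (ι → EuclideanSpace ℝ (Fin k)) := by
    rw [dimH_iUnion, hF]
    refine (iSup_le hD).trans_lt ?_
    norm_cast
    omega
  obtain ⟨c, hc, hc2⟩ := (dense_compl_of_dimH_lt_finrank hdim).exists_dist_lt 0 hη
  refine ⟨c, by simpa using hc2, ?_⟩
  rintro z ⟨v, s, T, hT, h⟩
  exact hc (Set.mem_iUnion.2 ⟨(v, s, T), hT, z, h⟩)

lemma assemble {X Q Λ : Type*} [MetricSpace X] [MetricSpace Q] [CompactSpace Q] (e : Q → X)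
    (he : Isometry e) (N : ℕ) (lev : Q → ℕ) (hlev : ∀ x, lev x < N) (lab : Q → Λ) {ε : ℝ}
    (hε : 0 < ε)
    (hloc : ∀ x, ∀ᶠ y in 𝓝 x, lev y = lev x → lab y = lab x)
    (hsm : ∀ x y, lev x = lev y → lab x = lab y → dist x y ≤ ε / 2) :
    ∃ γ : Finset (Set X), (∀ U ∈ γ, IsOpen U ∧ Metric.diam U ≤ ε) ∧
      Set.range e ⊆ ⋃₀ ↑γ ∧ ∀ x : X, {U ∈ (↑γ : Set (Set X)) | x ∈ U}.ncard ≤ N := by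
  classical
  have h1 : ∀ x, ∃ r > 0, ∀ y, dist y x < r → lev y = lev x → lab y = lab x := by
    intro x
    obtain ⟨r, hr, h⟩ := Metric.eventually_nhds_iff.1 (hloc x)
    exact ⟨r, hr, fun y hy => h hy⟩
  choose r hr hrl using h1
  let ρ : Q → ℝ := fun x => min (r x / 2) (ε / 4)
  have hρ : ∀ x, 0 < ρ x := fun x => lt_min (half_pos (hr x)) (by positivity)
  let U : ℕ × Λ → Set X := fun p => ⋃ x ∈ {x | lev x = p.1 ∧ lab x = p.2}, ball (e x) (ρ x)
  have hUo : ∀ p, IsOpen (U p) := fun p => isOpen_biUnion fun x _ => isOpen_ball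
  have hUd : ∀ p, Metric.diam (U p) ≤ ε := by
    intro p
    refine Metric.diam_le_of_forall_dist_le hε.le ?_
    intro a ha b hb
    simp only [U, Set.mem_iUnion, Set.mem_ofPred_eq, mem_ball] at ha hb
    obtain ⟨x, hx, hxa⟩ := ha
    obtain ⟨y, hy, hyb⟩ := hb
    have h2 := hsm x y (hx.1.trans hy.1.symm) (hx.2.trans hy.2.symm)
    rw [← he.dist_eq] at h2
    have h3 : ρ x ≤ ε / 4 := min_le_right _ _
    have h4 : ρ y ≤ ε / 4 := min_le_right _ _
    have h5 := dist_triangle4 a (e x) (e y) b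
    rw [dist_comm (e y) b] at h5
    linarith
  have hUdis : ∀ j l l' a, a ∈ U (j, l) → a ∈ U (j, l') → l = l' := by
    intro j l l' a ha hb
    simp only [U, Set.mem_iUnion, Set.mem_ofPred_eq, mem_ball] at ha hb
    obtain ⟨x, hx, hxa⟩ := ha
    obtain ⟨y, hy, hyb⟩ := hb
    have h3 : ρ x ≤ r x / 2 := min_le_left _ _
    have h4 : ρ y ≤ r y / 2 := min_le_left _ _
    have h5 := dist_triangle_left (e x) (e y) a
    rw [he.dist_eq] at h5
    rw [← hx.2, ← hy.2]
    rcases le_total (r x) (r y) with h | h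
    · exact hrl y x (by linarith) (hx.1.trans hy.1.symm)
    · exact (hrl x y (by rw [dist_comm]; linarith) (hy.1.trans hx.1.symm)).symm
  obtain ⟨F, hF⟩ := isCompact_univ.elim_finite_subcover (fun x : Q => ball x (ρ x))
    (fun x => isOpen_ball) (fun x _ => Set.mem_iUnion.2 ⟨x, mem_ball_self (hρ x)⟩)
  refine ⟨F.image fun x => U (lev x, lab x), ?_, ?_, ?_⟩
  · intro V hV
    obtain ⟨x, -, rfl⟩ := Finset.mem_image.1 hV
    exact ⟨hUo _, hUd _⟩
  · rintro _ ⟨y, rfl⟩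
    obtain ⟨x, hx, hy⟩ := Set.mem_iUnion₂.1 (hF (Set.mem_univ y))
    refine Set.mem_sUnion.2 ⟨U (lev x, lab x), by simpa using ⟨x, hx, rfl⟩, ?_⟩
    refine Set.mem_iUnion₂.2 ⟨x, ⟨rfl, rfl⟩, ?_⟩
    rw [mem_ball, he.dist_eq]; exact hy
  · intro a
    have hch : ∀ V : Set X, ∃ j : ℕ, V ∈ {V ∈ (↑(F.image fun x => U (lev x, lab x)) :
        Set (Set X)) | a ∈ V} → j < N ∧ ∃ l, V = U (j, l) := by
      intro V
      by_cases hV : V ∈ {V ∈ (↑(F.image fun x => U (lev x, lab x)) : Set (Set X)) | a ∈ V}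
      · obtain ⟨x, -, hx⟩ := Finset.mem_image.1 (Finset.mem_coe.1 hV.1)
        exact ⟨lev x, fun _ => ⟨hlev x, lab x, hx.symm⟩⟩
      · exact ⟨0, fun h => absurd h hV⟩
    choose jj hjj using hch
    have := Set.ncard_le_ncard_of_injOn (s := {V ∈ (↑(F.image fun x => U (lev x, lab x)) :
        Set (Set X)) | a ∈ V}) (t := (Finset.range N : Set ℕ)) jj
      (fun V hV => by simpa using (hjj V hV).1) (by
        intro V hV V' hV' h
        obtain ⟨-, l, hl⟩ := hjj V hV
        obtain ⟨-, l', hl'⟩ := hjj V' hV'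
        have h2 := hV.2
        have h2' := hV'.2
        rw [hl] at h2
        rw [hl', ← h] at h2'
        rw [hl, hl', ← h, hUdis _ _ _ _ h2 h2'])
    rwa [Set.ncard_coe_finset, Finset.card_range] at this

lemma exists_pou {K : Type*} [MetricSpace K] [CompactSpace K] {n : ℕ} (hK : CovDimLENat K n)
    {δ : ℝ} (hδ : 0 < δ) :
    ∃ (V : Set (Set K)) (t : Finset V) (φ : t → K → ℝ) (c : t → K),
      (∀ i, Continuous (φ i)) ∧ (∀ i x, 0 ≤ φ i x) ∧ (∀ x, ∑ i, φ i x = 1) ∧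
      (∀ x, {i | φ i x ≠ 0}.ncard ≤ n + 1) ∧ ∀ i x, φ i x ≠ 0 → dist x (c i) < δ := by
  classical
  obtain ⟨F, hF⟩ := isCompact_univ.elim_finite_subcover (fun x : K => ball x δ)
    (fun x => isOpen_ball) (fun x _ => Set.mem_iUnion.2 ⟨x, mem_ball_self hδ⟩)
  obtain ⟨V, hVo, hVc, hVr, hVn⟩ := hK ((fun x => ball x δ) '' (F : Set K))
    (F.finite_toSet.image _) (by rintro _ ⟨x, -, rfl⟩; exact isOpen_ball)
    (by
      rw [Set.sUnion_image]
      exact Set.eq_univ_of_univ_subset hF)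
  obtain ⟨t, ht⟩ := isCompact_univ.elim_finite_subcover (fun v : V => v.1)
    (fun v => hVo _ v.2) (by rw [← Set.sUnion_eq_iUnion, hVc])
  have hc : ∀ i : t, ∃ c : K, i.1.1 ⊆ ball c δ := by
    intro i
    obtain ⟨U, ⟨c, -, rfl⟩, h⟩ := hVr i.1.1 i.1.2
    exact ⟨c, h⟩
  choose c hc using hc
  obtain ⟨f, hf⟩ := PartitionOfUnity.exists_isSubordinate (s := (Set.univ : Set K)) isClosed_univ
    (fun i : t => i.1.1) (fun i => hVo _ i.1.2) (by
      intro x hx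
      obtain ⟨i, hi, hxi⟩ := Set.mem_iUnion₂.1 (ht hx)
      exact Set.mem_iUnion.2 ⟨⟨i, hi⟩, hxi⟩)
  have hsup : ∀ i x, f i x ≠ 0 → x ∈ i.1.1 := fun i x h => hf i (subset_tsupport _ h)
  refine ⟨V, t, fun i => f i, c, fun i => (f i).continuous, fun i x => f.nonneg i x, ?_, ?_, ?_⟩
  · intro x
    rw [← finsum_eq_sum_of_fintype]
    exact f.sum_eq_one (Set.mem_univ x)
  · intro x
    refine (Set.ncard_le_ncard_of_injOn (t := {W ∈ V | x ∈ W}) (fun i : t => i.1.1) ?_ ?_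
      (hVn x).1).trans (hVn x).2
    · intro i hi
      exact ⟨i.1.2, hsup i x hi⟩
    · intro i _ j _ h
      exact Subtype.ext (Subtype.ext h)
  · intro i x h
    exact hc i (hsup i x h)

/-- The key local statement: a fiber of a piecewise linear map. -/
lemma fiber_cover {X Q ι E : Type*} [MetricSpace X] [MetricSpace Q] [CompactSpace Q] (e : Q → X)
    (he : Isometry e) [Fintype ι] [AddCommGroup E] [Module ℝ E] (n k M : ℕ) (hk : k ≤ n)
    (φ : ι → Q → ℝ) (hφc : ∀ i, Continuous (φ i)) (hφ1 : ∀ x, ∑ i, φ i x = 1)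
    (hφn : ∀ x, {i | φ i x ≠ 0}.ncard ≤ n + 1) {δ ε : ℝ} (hδ : 0 < δ) (hε : 0 < ε)
    (hδε : (M + 1) * δ ≤ ε / 2)
    (hφd : ∀ i x y, φ i x ≠ 0 → φ i y ≠ 0 → dist x y ≤ δ)
    (p : ι → E) (t : E) (hp : ∀ x, ∑ i, φ i x • p i = t)
    (W : Finset ι) (hWM : W.card ≤ M) (hW : ∀ v ∉ W, ∀ s T, ¬ BadPos k p v s T) :
    ∃ γ : Finset (Set X), (∀ U ∈ γ, IsOpen U ∧ Metric.diam U ≤ ε) ∧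
      Set.range e ⊆ ⋃₀ ↑γ ∧ ∀ x : X, {U ∈ (↑γ : Set (Set X)) | x ∈ U}.ncard ≤ n - k + 1 := by
  classical
  have hδε' : δ ≤ ε / 2 := by
    have : (0 : ℝ) ≤ M * δ := by positivity
    linarith
  let S : Q → Finset ι := fun x => Finset.univ.filter fun i => φ i x ≠ 0
  have hS : ∀ x i, i ∈ S x ↔ φ i x ≠ 0 := fun x i => by simp [S]
  have hScard : ∀ x, (S x).card ≤ n + 1 := by
    intro x
    rw [← Set.ncard_coe_finset]
    convert hφn x using 2
    ext i; simp [S]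
  have hSloc : ∀ x, ∀ᶠ y in 𝓝 x, S x ⊆ S y := by
    intro x
    have : ∀ᶠ y in 𝓝 x, ∀ i ∈ S x, φ i y ≠ 0 := by
      rw [Filter.eventually_all_finset]
      intro i hi
      exact (hφc i).continuousAt.eventually_ne ((hS x i).1 hi)
    filter_upwards [this] with y hy i hi
    exact (hS y i).2 (hy i hi)
  have hSne : ∀ x, (S x).Nonempty := by
    intro x
    by_contra h
    rw [Finset.not_nonempty_iff_eq_empty] at h
    have h0 : ∑ i, φ i x = 0 := Finset.sum_eq_zero fun i _ => by
      by_contra hi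
      have := (hS x i).2 hi
      simp [h] at this
    rw [hφ1] at h0
    exact one_ne_zero h0
  choose ch hch using hSne
  -- the closed part
  let C : Q → Prop := fun x => ∀ μ : ι → ℝ, (∀ i, μ i ≠ 0 → i ∈ S x) → ∑ i, μ i = 0 →
    ∑ i, μ i • p i = 0 → ∀ v ∉ W, μ v = 0
  have hCeq : ∀ x y, C y → S x ⊆ S y → ∀ v ∉ W, φ v x = φ v y := by
    intro x y hy hxy v hv
    have := hy (fun i => φ i x - φ i y) (by
      intro i hi
      by_contra hiy
      have h1 : φ i y = 0 := by
        by_contra h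
        exact hiy ((hS y i).2 h)
      have h2 : φ i x = 0 := by
        by_contra h
        exact hiy (hxy ((hS x i).2 h))
      simp [h1, h2] at hi) (by rw [Finset.sum_sub_distrib, hφ1, hφ1, sub_self])
      (by simp only [sub_smul, Finset.sum_sub_distrib, hp, sub_self]) v hv
    linarith
  have hnC : ∀ x, ¬ C x → k + 2 ≤ (S x).card := by
    intro x hx
    by_contra hcard
    apply hx
    intro μ h1 h2 h3 v hv
    by_contra hμ
    have hsub : ∀ i ∉ S x, μ i = 0 := fun i hi => by
      by_contra h
      exact hi (h1 i h)
    obtain ⟨s, T, hb⟩ := badPos_of_rel (k := k) p (S x) (by omega) μ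
      (by rw [← h2]; exact Finset.sum_subset (Finset.subset_univ _) fun i _ hi => hsub i hi)
      (by rw [← h3]; exact Finset.sum_subset (Finset.subset_univ _)
            fun i _ hi => by rw [hsub i hi, zero_smul]) v (h1 v hμ) hμ
    exact hW v hv s T hb
  let lev : Q → ℕ := fun x => if C x then 0 else (S x).card - (k + 1)
  have hlev0 : ∀ x, C x → lev x = 0 := fun x h => by simp [lev, h]
  have hlev1 : ∀ x, ¬ C x → lev x = (S x).card - (k + 1) := fun x h => by simp [lev, h]
  have hlevC : ∀ x, lev x = 0 → C x := by
    intro x h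
    by_contra hx
    have := hnC x hx
    rw [hlev1 x hx] at h
    omega
  let G : SimpleGraph W := SimpleGraph.fromRel fun i j => ∃ x, i.1 ∈ S x ∧ j.1 ∈ S x
  have hGadj : ∀ i j : W, G.Adj i j → ∃ x, i.1 ∈ S x ∧ j.1 ∈ S x := by
    intro i j h
    rw [SimpleGraph.fromRel_adj] at h
    rcases h.2 with ⟨x, h⟩ | ⟨x, h⟩
    · exact ⟨x, h⟩
    · exact ⟨x, h.symm⟩
  have hGwalk : ∀ (i j : W) (w : G.Walk i j) (x y : Q), i.1 ∈ S x → j.1 ∈ S y →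
      dist x y ≤ (w.length + 1) * δ := by
    intro i j w
    induction w with
    | nil =>
      intro x y hx hy
      simpa using hφd _ x y ((hS _ _).1 hx) ((hS _ _).1 hy)
    | cons h w ih =>
      intro x y hx hy
      obtain ⟨u, hu1, hu2⟩ := hGadj _ _ h
      have h1 := hφd _ x u ((hS _ _).1 hx) ((hS _ _).1 hu1)
      have h2 := ih u y hu2 hy
      have h3 := dist_triangle x u y
      rw [SimpleGraph.Walk.length_cons]
      push_cast
      linarith
  let comp : Q → Option G.ConnectedComponent := fun x =>
    if h : S x ⊆ W then some (G.connectedComponentMk ⟨ch x, h (hch x)⟩) else none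
  let lab : Q → (ι → ℝ) × Option G.ConnectedComponent × Finset ι := fun x =>
    if C x then (fun v => if v ∈ W then 0 else φ v x, comp x, ∅) else (0, none, S x)
  have hlab0 : ∀ x, C x → lab x = (fun v => if v ∈ W then 0 else φ v x, comp x, ∅) :=
    fun x h => by simp [lab, h]
  have hlab1 : ∀ x, ¬ C x → lab x = (0, none, S x) := fun x h => by simp [lab, h]
  refine assemble e he (n - k + 1) lev ?_ lab hε ?_ ?_
  · intro x
    by_cases h : C x
    · rw [hlev0 x h]; omega
    · rw [hlev1 x h]
      have := hScard x
      omega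
  · intro x
    filter_upwards [hSloc x] with y hy hl
    by_cases hx : C x
    · have hCy := hlevC y (hl.trans (hlev0 x hx))
      rw [hlab0 x hx, hlab0 y hCy]
      have heq := hCeq x y hCy hy
      have hsub : S x ⊆ W → S y ⊆ W := by
        intro h i hi
        by_contra hiW
        refine hiW (h ((hS x i).2 ?_))
        rw [heq i hiW]
        exact (hS y i).1 hi
      refine Prod.ext ?_ (Prod.ext ?_ rfl)
      · funext v
        by_cases hv : v ∈ W
        · simp [hv]
        · simp [hv, heq v hv]
      · simp only [comp]
        by_cases hxW : S x ⊆ W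
        · have hyW := hsub hxW
          simp only [hxW, hyW, dite_true, Option.some.injEq, SimpleGraph.ConnectedComponent.eq]
          by_cases hc : ch y = ch x
          · simp only [hc]; exact SimpleGraph.Reachable.refl _
          · refine SimpleGraph.Adj.reachable ?_
            rw [SimpleGraph.fromRel_adj]
            exact ⟨fun h => hc (congrArg Subtype.val h), Or.inl ⟨y, hch y, hy (hch x)⟩⟩
        · have hyW : ¬ S y ⊆ W := fun h => hxW (hy.trans h)
          simp only [hxW, hyW, dite_false]
    · have h1 := hnC x hx
      have hCy : ¬ C y := by
        intro h
        rw [hlev0 y h, hlev1 x hx] at hl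
        omega
      have h2 := hnC y hCy
      rw [hlev1 y hCy, hlev1 x hx] at hl
      rw [hlab1 x hx, hlab1 y hCy, Finset.eq_of_subset_of_card_le hy (by omega)]
  · intro x y hl hlab
    by_cases hx : C x
    · have hy : C y := hlevC y (hl.symm.trans (hlev0 x hx))
      rw [hlab0 x hx, hlab0 y hy] at hlab
      obtain ⟨h1, h2, -⟩ := by simpa only [Prod.mk.injEq] using hlab
      by_cases hxW : S x ⊆ W
      · by_cases hyW : S y ⊆ W
        · simp only [comp, hxW, hyW, dite_true, Option.some.injEq,
            SimpleGraph.ConnectedComponent.eq] at h2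
          obtain ⟨w, hw⟩ := h2.exists_isPath
          have h3 := hGwalk _ _ w x y (hch x) (hch y)
          have h4 := hw.length_lt
          rw [Fintype.card_coe] at h4
          have h5 : (w.length : ℝ) ≤ M := by exact_mod_cast (h4.le.trans hWM)
          have h6 : (w.length + 1) * δ ≤ (M + 1) * δ := by gcongr
          linarith
        · simp [comp, hxW, hyW] at h2
      · obtain ⟨i, hi, hiW⟩ := Finset.not_subset.1 hxW
        have h3 := congrFun h1 i
        simp only [hiW, if_false] at h3
        have h4 := (hS x i).1 hi
        exact (hφd i x y h4 (h3 ▸ h4)).trans hδε'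
    · have hy : ¬ C y := by
        intro h
        have := hnC x hx
        rw [hlev0 y h, hlev1 x hx] at hl
        omega
      rw [hlab1 x hx, hlab1 y hy] at hlab
      obtain ⟨-, -, h1⟩ := by simpa only [Prod.mk.injEq] using hlab
      have h2 := (hS x _).1 (hch x)
      have h3 := (hS y (ch x)).1 (h1 ▸ hch x)
      exact (hφd _ x y h2 h3).trans hδε'

/-- The density statement for a compact subset. -/
lemma dense_core {X : Type*} [MetricSpace X] (K : Set X) (hKc : IsCompact K)
    (n k : ℕ) (hk : k ≤ n) (hdim : CovDimLE K n) (ε : ℝ) (hε : 0 < ε) (m : ℕ) :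
    Dense {g : C((Fin m → unitInterval) × K, EuclideanSpace ℝ (Fin k)) |
      ∀ z : Fin m → unitInterval, ∀ t : EuclideanSpace ℝ (Fin k),
        ∃ γ : Finset (Set X),
          (∀ U ∈ γ, IsOpen U ∧ Metric.diam U ≤ ε) ∧
          {x : X | ∃ hx : x ∈ K, g (z, ⟨x, hx⟩) = t} ⊆ ⋃₀ ↑γ ∧
          ∀ x : X, {U ∈ (↑γ : Set (Set X)) | x ∈ U}.ncard ≤ n - k + 1} := by
  classical
  haveI : CompactSpace K := isCompact_iff_compactSpace.1 hKc
  rcases hdim with hE | ⟨n', hn', hdim⟩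
  · intro g
    refine subset_closure fun z t => ⟨∅, by simp, ?_, by simp⟩
    rintro x ⟨hx, -⟩
    exact hE.elim ⟨x, hx⟩
  have hn' : n' ≤ n := by exact_mod_cast hn'
  intro g0
  rw [Metric.mem_closure_iff]
  intro η hη
  have huc : UniformContinuous g0 := CompactSpace.uniformContinuous_of_continuous g0.continuous
  obtain ⟨δ0, hδ0, hg0⟩ := Metric.uniformContinuous_iff.1 huc (η / 4) (by positivity)
  let M : ℕ := m * (k + 1)
  let δ : ℝ := min δ0 (ε / (4 * (M + 1)))
  have hδ : 0 < δ := lt_min hδ0 (by positivity)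
  obtain ⟨V, T, φ, cen, hφc, hφ0, hφ1, hφn, hφd⟩ := exists_pou hdim hδ
  -- smooth approximation of the vertex functions
  let a0 : (Fin m → ℝ) → T → EuclideanSpace ℝ (Fin k) := fun w i =>
    g0 (fun l => Set.projIcc (0 : ℝ) 1 zero_le_one (w l), cen i)
  have ha0 : Continuous a0 := by
    refine continuous_pi fun i => g0.continuous.comp ?_
    refine Continuous.prodMk (continuous_pi fun l => ?_) continuous_const
    exact continuous_projIcc.comp (continuous_apply l)
  obtain ⟨a, ha, haa, -⟩ := ha0.exists_contDiff_approx 1 (ε := fun _ => η / 4) continuous_const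
    (fun _ => by positivity)
  obtain ⟨c, hc, hcg⟩ := exists_generic a ha (η := η / 4) (by positivity)
  let em : (Fin m → unitInterval) → (Fin m → ℝ) := fun z l => (z l : ℝ)
  have hem : Continuous em := by fun_prop
  let g : C((Fin m → unitInterval) × K, EuclideanSpace ℝ (Fin k)) :=
    ⟨fun q => ∑ i, φ i q.2 • (a (em q.1) + c) i, by
      refine continuous_finset_sum _ fun i _ => Continuous.smul ((hφc i).comp continuous_snd) ?_
      exact (continuous_apply i).comp
        (((ha.continuous.comp hem).comp continuous_fst).add continuous_const)⟩
  have hg : ∀ z x, g (z, x) = ∑ i, φ i x • (a (em z) + c) i := fun z x => rfl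
  refine ⟨g, ?_, ?_⟩
  · intro z t
    obtain ⟨W, hWM, hW⟩ := exists_small_W (k := k) (a (em z) + c) (hcg (em z))
    let Q := {x : K // g (z, x) = t}
    haveI : CompactSpace Q := by
      refine isCompact_iff_compactSpace.1 (IsClosed.isCompact ?_)
      exact isClosed_eq (by fun_prop) continuous_const
    obtain ⟨γ, h1, h2, h3⟩ := fiber_cover (Q := Q) (fun x => x.1.1)
      (isometry_subtype_coe.comp isometry_subtype_coe) n k M hk (fun i x => φ i x.1)
      (fun i => (hφc i).comp continuous_subtype_val) (fun x => hφ1 x.1)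
      (fun x => (hφn x.1).trans (by omega)) (δ := 2 * δ) (by positivity) hε
      (by
        have h4 : δ ≤ ε / (4 * (M + 1)) := min_le_right _ _
        rw [le_div_iff₀ (by positivity)] at h4
        linarith)
      (by
        intro i x y hx hy
        have h4 := hφd i x.1 hx
        have h5 := hφd i y.1 hy
        have h6 := dist_triangle_right x.1 y.1 (cen i)
        have h7 : dist x y = dist x.1 y.1 := rfl
        linarith)
      (a (em z) + c) t (fun x => x.2) W hWM hW
    refine ⟨γ, h1, ?_, h3⟩
    rintro x ⟨hx, hxt⟩
    exact h2 ⟨⟨⟨x, hx⟩, hxt⟩, rfl⟩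
  · rw [ContinuousMap.dist_lt_iff hη]
    rintro ⟨z, x⟩
    rw [hg, dist_comm, dist_eq_norm]
    have e1 : ∑ i, φ i x • (a (em z) + c) i - g0 (z, x)
        = ∑ i, φ i x • ((a (em z) + c) i - g0 (z, x)) := by
      simp only [smul_sub, Finset.sum_sub_distrib, ← Finset.sum_smul, hφ1, one_smul]
    have e2 : ‖∑ i, φ i x • ((a (em z) + c) i - g0 (z, x))‖ ≤ ∑ i, φ i x * (3 * η / 4) := by
      refine norm_sum_le_of_le _ fun i _ => ?_
      rw [norm_smul, Real.norm_of_nonneg (hφ0 i x)]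
      by_cases hi : φ i x = 0
      · simp [hi]
      refine mul_le_mul_of_nonneg_left ?_ (hφ0 i x)
      have h1 : ‖c i‖ ≤ η / 4 := (norm_le_pi_norm c i).trans hc.le
      have h2 : dist (a (em z) i) (a0 (em z) i) ≤ η / 4 :=
        (dist_le_pi_dist _ _ i).trans (haa (em z)).le
      have h3 : a0 (em z) i = g0 (z, cen i) := by
        simp only [a0, em]
        congr 2
        funext l
        exact Set.projIcc_val zero_le_one (z l)
      have h4 : dist (g0 (z, cen i)) (g0 (z, x)) < η / 4 := by
        apply hg0
        rw [Prod.dist_eq, dist_self, max_eq_right dist_nonneg, dist_comm]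
        exact (hφd i x hi).trans_le (min_le_left _ _)
      rw [h3, dist_eq_norm] at h2
      rw [dist_eq_norm] at h4
      have h5 : (a (em z) + c) i - g0 (z, x)
          = (a (em z) i - g0 (z, cen i)) + c i + (g0 (z, cen i) - g0 (z, x)) := by
        rw [Pi.add_apply]; abel
      rw [h5]
      refine (norm_add₃_le).trans ?_
      linarith
    rw [e1]
    refine e2.trans_lt ?_
    rw [← Finset.sum_mul, hφ1]
    linarith

/-- (Lemma 4.3) The maps on `𝕀^m × f⁻¹(y)` all of whose slices belong to
`𝒞_ε(y)` (i.e. each slice fiber admits a finite open cover in `X` of mesh `≤ ε` and order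
`≤ n - k + 1`) are dense in `C(𝕀^m × f⁻¹(y), ℝ^k)` (uniform convergence topology). -/
theorem statement11 {X Y : Type*} [MetricSpace X] [TopologicalSpace Y]
    [TopologicalSpace.MetrizableSpace Y]
    (n k : ℕ) (hk : k ≤ n) (f : X → Y) (hf : IsPerfectMap f)
    (hfsurj : Function.Surjective f) (hfdim : DimMapLE f n)
    (ε : ℝ) (hε : 0 < ε) (m : ℕ) (hm : 1 ≤ m) (y : Y) :
    Dense {g : C((Fin m → unitInterval) × ↥(f ⁻¹' {y}), EuclideanSpace ℝ (Fin k)) |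
      ∀ z : Fin m → unitInterval, ∀ t : EuclideanSpace ℝ (Fin k),
        ∃ γ : Finset (Set X),
          (∀ U ∈ γ, IsOpen U ∧ Metric.diam U ≤ ε) ∧
          {x : X | ∃ hx : x ∈ f ⁻¹' {y}, g (z, ⟨x, hx⟩) = t} ⊆ ⋃₀ ↑γ ∧
          ∀ x : X, {U ∈ (↑γ : Set (Set X)) | x ∈ U}.ncard ≤ n - k + 1} := by
  exact dense_core (f ⁻¹' {y}) (hf.2.2 y) n k hk (hfdim y) ε hε m
end

section
/- Let K be a metrizable compactum with dim K ≤ n and let 0 ≤ k ≤ n. Then for every m ≥ 1 the set of all maps g ∈ C(𝕀^m × K, ℝ^k) such that the map π×g : 𝕀^m × K → 𝕀^m × ℝ^k is (n − k)-dimensional is dense in C(𝕀^m × K, ℝ^k) with respect to the uniform convergence topology, where π : 𝕀^m × K → 𝕀^m denotes the projection. -/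
open Set Topology Metric BoundedContinuousFunction

/-- Lipschitz approximation on a compact metric space. -/
theorem lip_approx {X : Type*} [MetricSpace X] [CompactSpace X] [Nonempty X] (f : X → ℝ)
    (hf : Continuous f) (η : ℝ) (hη : 0 < η) :
    ∃ p : X → ℝ, (∃ C, LipschitzWith C p) ∧ ∀ t, |p t - f t| ≤ η := by
  have huc : UniformContinuous f := CompactSpace.uniformContinuous_of_continuous hf
  obtain ⟨δ, hδ, hd⟩ := Metric.uniformContinuous_iff.1 huc η hη
  obtain ⟨B, hB⟩ := (isCompact_range hf).isBounded.exists_norm_le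
  have hB' : ∀ t, |f t| ≤ B := fun t => hB (f t) (mem_range_self t)
  have hB0 : 0 ≤ B := (abs_nonneg _).trans (hB' (Classical.arbitrary X))
  set L : ℝ := 2 * B / δ with hL
  have hL0 : 0 ≤ L := by positivity
  have hbdd : ∀ t, BddBelow (range fun s => f s + L * dist s t) := by
    intro t
    refine ⟨-B, ?_⟩
    rintro _ ⟨s, rfl⟩
    have h1 := (abs_le.1 (hB' s)).1
    have h2 : 0 ≤ L * dist s t := by positivity
    show -B ≤ f s + L * dist s t
    linarith
  refine ⟨fun t => ⨅ s, f s + L * dist s t, ⟨⟨L, hL0⟩, ?_⟩, ?_⟩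
  · refine LipschitzWith.of_le_add_mul _ fun t t' => ?_
    rw [← sub_le_iff_le_add]
    refine le_ciInf fun s => ?_
    rw [sub_le_iff_le_add]
    refine (ciInf_le (hbdd t) s).trans ?_
    have h1 : dist s t ≤ dist s t' + dist t t' := by
      rw [dist_comm t t']; exact dist_triangle _ _ _
    have h2 := mul_le_mul_of_nonneg_left h1 hL0
    show f s + L * dist s t ≤ f s + L * dist s t' + L * dist t t'
    linarith
  · intro t
    have h1 : (⨅ s, f s + L * dist s t) ≤ f t := by
      refine (ciInf_le (hbdd t) t).trans ?_
      simp
    have h2 : f t - η ≤ ⨅ s, f s + L * dist s t := by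
      refine le_ciInf fun s => ?_
      by_cases hs : dist s t < δ
      · have h3 := hd hs
        rw [Real.dist_eq] at h3
        have h4 := (abs_lt.1 h3).1
        have h5 : 0 ≤ L * dist s t := by positivity
        linarith
      · have h3 : L * δ ≤ L * dist s t := mul_le_mul_of_nonneg_left (not_lt.1 hs) hL0
        have h4 : L * δ = 2 * B := by rw [hL]; field_simp
        have h5 := (abs_le.1 (hB' s)).1
        have h6 := (abs_le.1 (hB' t)).2
        linarith
    rw [abs_le]
    constructor <;> linarith

/-- The Hausdorff dimension of the cube is at most `m`. -/
theorem dimH_cube (m : ℕ) : dimH (univ : Set (Fin m → unitInterval)) ≤ m := by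
  have hi : Isometry (fun (t : Fin m → unitInterval) (i : Fin m) => (t i : ℝ)) := by
    refine Isometry.of_dist_eq fun x y => ?_
    simp only [dist_pi_def]
    rfl
  rw [← hi.dimH_image, ← Real.dimH_univ_pi_fin]
  exact dimH_mono (subset_univ _)

/-- Generic vertical translations of Lipschitz functions on the `m`-cube have at most `m + 1`
coincidences at every point. -/
theorem generic_shift {ι : Type*} [Fintype ι] (m : ℕ) (p : ι → (Fin m → unitInterval) → ℝ)
    (hp : ∀ i, ∃ C, LipschitzWith C (p i)) (δ : ℝ) (hδ : 0 < δ) :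
    ∃ s : ι → ℝ, (∀ i, |s i| ≤ δ) ∧ ∀ t y, ∀ S : Finset ι,
      (∀ i ∈ S, p i t + s i = y) → S.card ≤ m + 1 := by
  classical
  let Φ : (Fin (m + 2) ↪ ι) → (Fin m → unitInterval) → (Fin (m + 1) → ℝ) :=
    fun e t l => p (e 0) t - p (e l.succ) t
  have hΦ : ∀ e, ∃ C, LipschitzWith C (Φ e) := by
    intro e
    choose C hC using hp
    refine ⟨∑ i, C i + ∑ i, C i, LipschitzWith.of_dist_le_mul fun x y => ?_⟩
    refine (dist_pi_le_iff (by positivity)).2 fun l => ?_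
    have h1 : ∀ i, dist (p i x) (p i y) ≤ ((∑ i, C i : NNReal) : ℝ) * dist x y := by
      intro i
      refine ((hC i).dist_le_mul x y).trans ?_
      refine mul_le_mul_of_nonneg_right ?_ dist_nonneg
      exact_mod_cast Finset.single_le_sum (f := C) (fun _ _ => bot_le) (Finset.mem_univ i)
    have h2 : dist (Φ e x l) (Φ e y l) ≤ dist (p (e 0) x) (p (e 0) y)
        + dist (p (e l.succ) x) (p (e l.succ) y) := dist_sub_sub_le _ _ _ _
    refine h2.trans ?_
    rw [NNReal.coe_add, add_mul]
    exact add_le_add (h1 _) (h1 _)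
  let D : (Fin (m + 2) ↪ ι) → (ι → ℝ) →ₗ[ℝ] (Fin (m + 1) → ℝ) := fun e =>
    LinearMap.pi fun l => LinearMap.proj (R := ℝ) (φ := fun _ : ι => ℝ) (e l.succ) -
      LinearMap.proj (R := ℝ) (φ := fun _ : ι => ℝ) (e 0)
  have hD : ∀ e, Function.Surjective (D e) := by
    intro e v
    refine ⟨fun i => if h : ∃ l : Fin (m + 1), e l.succ = i then v h.choose else 0, ?_⟩
    funext l
    have h1 : ∃ l' : Fin (m + 1), e l'.succ = e l.succ := ⟨l, rfl⟩
    have h2 : h1.choose = l := Fin.succ_injective _ (e.injective h1.choose_spec)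
    have h3 : ¬ ∃ l' : Fin (m + 1), e l'.succ = e 0 := by
      rintro ⟨l', h⟩
      exact Fin.succ_ne_zero l' (e.injective h)
    simp only [D, LinearMap.pi_apply, LinearMap.sub_apply, LinearMap.proj_apply]
    rw [dif_pos h1, dif_neg h3, h2, sub_zero]
  let G : (Fin (m + 2) ↪ ι) → Set (ι → ℝ) := fun e => D e ⁻¹' (range (Φ e))ᶜ
  have hGo : ∀ e, IsOpen (G e) := by
    intro e
    obtain ⟨C, hC⟩ := hΦ e
    exact (isCompact_range hC.continuous).isClosed.isOpen_compl.preimage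
      (LinearMap.continuous_of_finiteDimensional (D e))
  have hGd : ∀ e, Dense (G e) := by
    intro e
    obtain ⟨C, hC⟩ := hΦ e
    have h1 : Dense (range (Φ e))ᶜ := by
      apply dense_compl_of_dimH_lt_finrank
      refine (hC.dimH_range_le.trans (dimH_cube m)).trans_lt ?_
      rw [Module.finrank_fin_fun]
      exact_mod_cast Nat.lt_succ_self m
    exact h1.preimage ((D e).isOpenMap_of_finiteDimensional (hD e))
  have hd : Dense (⋂ e, G e) := dense_iInter_of_isOpen hGo hGd
  obtain ⟨s, hsG, hs⟩ := hd.exists_dist_lt 0 hδ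
  refine ⟨s, fun i => ?_, ?_⟩
  · have h1 := dist_le_pi_dist (0 : ι → ℝ) s i
    rw [dist_comm, Real.dist_eq] at h1
    simp only [Pi.zero_apply, sub_zero] at h1
    exact h1.trans hs.le
  · intro t y S hS
    by_contra hcard
    push Not at hcard
    obtain ⟨T, hTS, hT⟩ := Finset.exists_subset_card_eq (show m + 2 ≤ S.card by omega)
    let e : Fin (m + 2) ↪ ι := ((T.equivFinOfCardEq hT).symm.toEmbedding).trans
      (Function.Embedding.subtype _)
    have he : ∀ l, p (e l) t + s (e l) = y := fun l =>
      hS _ (hTS ((T.equivFinOfCardEq hT).symm l).2)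
    have h1 := mem_iInter.1 hsG e
    apply h1
    refine ⟨t, ?_⟩
    funext l
    simp only [D, Φ, LinearMap.pi_apply, LinearMap.sub_apply, LinearMap.proj_apply]
    have h2 := he 0
    have h3 := he l.succ
    linarith

/-- A set is covered by `r` disjoint families of small open sets. -/
def SmallCov {K : Type*} [MetricSpace K] (F : Set K) (r : ℕ) (ε : ℝ) : Prop :=
  ∃ 𝒲 : Fin r → Set (Set K), (∀ j, ∀ W ∈ 𝒲 j, IsOpen W ∧ ∀ x ∈ W, ∀ y ∈ W, dist x y < ε) ∧
    (∀ j, (𝒲 j).PairwiseDisjoint id) ∧ F ⊆ ⋃ j, ⋃₀ 𝒲 j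

theorem SmallCov.mono {K : Type*} [MetricSpace K] {F F' : Set K} {r : ℕ} {ε ε' : ℝ}
    (h : SmallCov F r ε) (hF : F' ⊆ F) (hε : ε ≤ ε') : SmallCov F' r ε' := by
  obtain ⟨𝒲, h1, h2, h3⟩ := h
  exact ⟨𝒲, fun j W hW => ⟨(h1 j W hW).1, fun x hx y hy => ((h1 j W hW).2 x hx y hy).trans_le hε⟩,
    h2, hF.trans h3⟩

theorem SmallCov.insert {K : Type*} [MetricSpace K] {F C : Set K} {r : ℕ} {ε : ℝ}
    (h : SmallCov F (r + 1) ε) (hC : IsOpen C) (hCε : ∀ x ∈ C, ∀ y ∈ C, dist x y < ε) :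
    SmallCov (F ∪ C) (r + 1) (3 * ε) := by
  obtain ⟨𝒲, h1, h2, h3⟩ := h
  set C' : Set K := C ∪ ⋃₀ {W ∈ 𝒲 0 | (W ∩ C).Nonempty} with hC'
  have key : ∀ x ∈ C', ∃ c ∈ C, dist x c < ε := by
    rintro x (hx | ⟨W, ⟨hW, c, hcW, hcC⟩, hxW⟩)
    · exact ⟨x, hx, hCε x hx x hx⟩
    · exact ⟨c, hcC, (h1 0 W hW).2 x hxW c hcW⟩
  have hεpos : ∀ j, ∀ W ∈ 𝒲 j, ∀ x ∈ W, ∀ y ∈ W, dist x y < 3 * ε := by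
    intro j W hW x hx y hy
    have h5 := (h1 j W hW).2 x hx y hy
    have h6 : (0 : ℝ) ≤ dist x y := dist_nonneg
    linarith
  have hdisj : ∀ W ∈ 𝒲 0, ¬ (W ∩ C).Nonempty → Disjoint W C' := by
    intro W hW hn
    rw [Set.disjoint_left]
    rintro x hx (hxC | ⟨W', ⟨hW', hn'⟩, hxW'⟩)
    · exact hn ⟨x, hx, hxC⟩
    · have hne : W ≠ W' := by rintro rfl; exact hn hn'
      exact Set.disjoint_left.1 (h2 0 hW hW' hne) hx hxW'
  refine ⟨fun j => if j = 0 then Insert.insert C' {W ∈ 𝒲 0 | ¬ (W ∩ C).Nonempty} else 𝒲 j,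
    ?_, ?_, ?_⟩
  · intro j W hW
    by_cases hj : j = 0
    · simp only [hj, if_true] at hW
      rcases hW with rfl | ⟨hW, -⟩
      · refine ⟨hC.union (isOpen_sUnion fun W hW => (h1 0 W hW.1).1), fun x hx y hy => ?_⟩
        obtain ⟨c, hc, hxc⟩ := key x hx
        obtain ⟨d, hd, hyd⟩ := key y hy
        have h4 := hCε c hc d hd
        have h5 := dist_triangle4_right x y c d
        have h6 := dist_triangle x c y
        have h7 := dist_triangle c d y
        rw [dist_comm d y] at h7
        linarith
      · exact ⟨(h1 0 W hW).1, hεpos 0 W hW⟩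
    · simp only [hj, if_false] at hW
      exact ⟨(h1 j W hW).1, hεpos j W hW⟩
  · intro j
    by_cases hj : j = 0
    · simp only [hj, if_true]
      intro W hW W' hW' hne
      rcases hW with rfl | ⟨hW, hn⟩
      · rcases hW' with rfl | ⟨hW', hn'⟩
        · exact absurd rfl hne
        · exact (hdisj W' hW' hn').symm
      · rcases hW' with rfl | ⟨hW', hn'⟩
        · exact hdisj W hW hn
        · exact h2 0 hW hW' hne
    · simp only [hj, if_false]
      exact h2 j
  · rintro x (hx | hx)
    · obtain ⟨j, W, hW, hxW⟩ := mem_iUnion.1 (h3 hx)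
      refine mem_iUnion.2 ⟨j, ?_⟩
      by_cases hj : j = 0
      · subst hj
        simp only [if_true]
        by_cases hn : (W ∩ C).Nonempty
        · exact ⟨C', mem_insert _ _, Or.inr ⟨W, ⟨hW, hn⟩, hxW⟩⟩
        · exact ⟨W, mem_insert_of_mem _ ⟨hW, hn⟩, hxW⟩
      · simp only [hj, if_false]
        exact ⟨W, hW, hxW⟩
    · refine mem_iUnion.2 ⟨0, C', ?_, Or.inl hx⟩
      simp only [if_true]
      exact mem_insert _ _

theorem SmallCov.insert_finset {K ι : Type*} [MetricSpace K] {F : Set K} {W : ι → Set K} {r : ℕ}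
    {ε : ℝ} (hε : 0 < ε) (h : SmallCov F (r + 1) ε) (hW : ∀ i, IsOpen (W i))
    (hWε : ∀ i, ∀ x ∈ W i, ∀ y ∈ W i, dist x y < ε) (S : Finset ι) :
    SmallCov (F ∪ ⋃ i ∈ S, W i) (r + 1) (3 ^ S.card * ε) := by
  classical
  induction S using Finset.induction_on with
  | empty => simpa using h
  | insert a S ha ih =>
    have h1 : ε ≤ 3 ^ S.card * ε :=
      le_mul_of_one_le_left hε.le (one_le_pow₀ (by norm_num))
    have h2 := ih.insert (hW a) fun x hx y hy => (hWε a x hx y hy).trans_le h1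
    rw [Finset.card_insert_of_notMem ha]
    refine h2.mono ?_ (by rw [pow_succ]; linarith)
    intro x hx
    simp only [mem_union, mem_iUnion, Finset.mem_insert] at hx ⊢
    rcases hx with hx | ⟨i, rfl | hi, hx⟩
    · exact Or.inl (Or.inl hx)
    · exact Or.inr hx
    · exact Or.inl (Or.inr ⟨i, hi, hx⟩)

/-- Decomposition of a compactum of dimension at most `n` into `n + 1` disjoint families of small
open sets. -/
theorem exists_levels {K : Type*} [MetricSpace K] [CompactSpace K] {n : ℕ} (hK : CovDimLENat K n)
    (ε : ℝ) (hε : 0 < ε) :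
    ∃ (N : ℕ) (lev : Finset (Fin N) → ℕ) (W : Finset (Fin N) → Set K),
      (∀ i, IsOpen (W i)) ∧ (∀ i, ∀ x ∈ W i, ∀ y ∈ W i, dist x y < ε) ∧
      (∀ i j, lev i = lev j → i ≠ j → Disjoint (W i) (W j)) ∧
      ∀ x, ∃ i, x ∈ W i ∧ lev i ≤ n := by
  classical
  obtain ⟨T, -, hTf, hT⟩ := (isCompact_univ (X := K)).elim_finite_subcover_image (b := univ)
    (c := fun x => ball x (ε / 2)) (fun _ _ => isOpen_ball)
    (fun x _ => mem_iUnion₂.2 ⟨x, mem_univ _, mem_ball_self (by linarith)⟩)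
  obtain ⟨𝒱, hVo, hVc, hVr, hVn⟩ := hK ((fun x => ball x (ε / 2)) '' T) (hTf.image _)
    (by rintro _ ⟨x, -, rfl⟩; exact isOpen_ball)
    (by rw [sUnion_image]; exact univ_subset_iff.1 hT)
  obtain ⟨𝒲, hWV, hWf, hWc⟩ := (isCompact_univ (X := K)).elim_finite_subcover_image (b := 𝒱)
    (c := id) hVo (by rw [← hVc, sUnion_eq_biUnion]; rfl)
  obtain ⟨N, U, hU⟩ : ∃ N : ℕ, ∃ U : Fin N → Set K, Function.Injective U ∧ range U = 𝒲 := by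
    have := hWf.fintype
    refine ⟨Fintype.card 𝒲, fun i => ((Fintype.equivFin 𝒲).symm i : Set K), ?_, ?_⟩
    · exact Subtype.val_injective.comp (Equiv.injective _)
    · ext A
      constructor
      · rintro ⟨i, rfl⟩; exact Subtype.mem _
      · intro hA; exact ⟨Fintype.equivFin 𝒲 ⟨A, hA⟩, by simp⟩
  obtain ⟨hUi, hUr⟩ := hU
  have hUV : ∀ i, U i ∈ 𝒱 := fun i => hWV (hUr ▸ mem_range_self i)
  let f : Fin N → K → ENNReal := fun i x => infEDist x (U i)ᶜ
  have hfc : ∀ i, Continuous (f i) := fun i => continuous_infEDist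
  have hfpos : ∀ i x, 0 < f i x ↔ x ∈ U i := by
    intro i x
    rw [pos_iff_ne_zero, Ne, ← mem_iff_infEDist_zero_of_closed (hVo _ (hUV i)).isClosed_compl]
    simp
  refine ⟨N, fun S => S.card - 1, fun S => if S.Nonempty then
    {x | (∀ i ∈ S, 0 < f i x) ∧ ∀ i ∈ S, ∀ l ∈ Sᶜ, f l x < f i x} else ∅, ?_, ?_, ?_, ?_⟩
  · intro S
    beta_reduce
    split_ifs
    · have h1 : {x | (∀ i ∈ S, 0 < f i x) ∧ ∀ i ∈ S, ∀ l ∈ Sᶜ, f l x < f i x} =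
          (⋂ i ∈ S, {x | 0 < f i x}) ∩ ⋂ i ∈ S, ⋂ l ∈ Sᶜ, {x | f l x < f i x} := by
        ext x; simp
      rw [h1]
      refine IsOpen.inter ?_ ?_
      · exact isOpen_biInter_finset fun i _ => isOpen_lt continuous_const (hfc i)
      · exact isOpen_biInter_finset fun i _ => isOpen_biInter_finset fun l _ =>
          isOpen_lt (hfc l) (hfc i)
    · exact isOpen_empty
  · intro S x hx y hy
    simp only at hx hy
    split_ifs at hx hy with hS
    · obtain ⟨i, hi⟩ := hS
      have hxi := (hfpos i x).1 (hx.1 i hi)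
      have hyi := (hfpos i y).1 (hy.1 i hi)
      obtain ⟨_, ⟨c, -, rfl⟩, hc⟩ := hVr _ (hUV i)
      have h1 := mem_ball.1 (hc hxi)
      have h2 := mem_ball.1 (hc hyi)
      have h3 := dist_triangle_right x y c
      linarith
    · exact absurd hx (notMem_empty _)
  · intro S S' hcard hne
    rw [Set.disjoint_left]
    intro x hx hx'
    beta_reduce at hx hx' hcard
    split_ifs at hx hx' with hS hS'
    · have hc : S.card = S'.card := by
        have := hS.card_pos
        have := hS'.card_pos
        omega
      have h1 : ¬ S ⊆ S' := fun h => hne (Finset.eq_of_subset_of_card_le h hc.ge)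
      have h2 : ¬ S' ⊆ S := fun h => hne (Finset.eq_of_subset_of_card_le h hc.le).symm
      obtain ⟨i, hi, hi'⟩ := Finset.not_subset.1 h1
      obtain ⟨l, hl, hl'⟩ := Finset.not_subset.1 h2
      have h3 := hx.2 i hi l (Finset.mem_compl.2 hl')
      have h4 := hx'.2 l hl i (Finset.mem_compl.2 hi')
      exact lt_asymm h3 h4
    all_goals first | exact hx | exact hx'
  · intro x
    let S : Finset (Fin N) := Finset.univ.filter fun i => x ∈ U i
    have hS : S.Nonempty := by
      obtain ⟨A, hA, hxA⟩ := mem_iUnion₂.1 (hWc (mem_univ x))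
      rw [← hUr] at hA
      obtain ⟨i, rfl⟩ := hA
      exact ⟨i, by simp only [S, Finset.mem_filter]; exact ⟨Finset.mem_univ _, hxA⟩⟩
    refine ⟨S, ?_, ?_⟩
    · beta_reduce
      rw [if_pos hS]
      refine ⟨fun i hi => (hfpos i x).2 (Finset.mem_filter.1 hi).2, fun i hi l hl => ?_⟩
      have h1 : f l x = 0 := by
        by_contra h
        have h2 := (hfpos l x).1 (pos_iff_ne_zero.2 h)
        exact Finset.mem_compl.1 hl (Finset.mem_filter.2 ⟨Finset.mem_univ _, h2⟩)
      rw [h1]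
      exact (hfpos i x).2 (Finset.mem_filter.1 hi).2
    · have h1 : (S.image U).card = S.card := Finset.card_image_of_injective _ hUi
      have h2 : ((S.image U : Finset (Set K)) : Set (Set K)) ⊆ {V ∈ 𝒱 | x ∈ V} := by
        intro A hA
        simp only [Finset.coe_image, mem_image, Finset.mem_coe] at hA
        obtain ⟨i, hi, rfl⟩ := hA
        exact ⟨hUV i, (Finset.mem_filter.1 hi).2⟩
      have h3 := Set.ncard_le_ncard h2 (hVn x).1
      rw [Set.ncard_coe_finset, h1] at h3
      have h4 := (hVn x).2
      show S.card - 1 ≤ n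
      omega

theorem dense_step {K : Type*} [MetricSpace K] [CompactSpace K] {n k : ℕ} (hk : k ≤ n)
    (hK : CovDimLENat K n) (m : ℕ) (g : C((Fin m → unitInterval) × K, EuclideanSpace ℝ (Fin k)))
    (ε δ : ℝ) (hε : 0 < ε) (hδ : 0 < δ) :
    ∃ g' : C((Fin m → unitInterval) × K, EuclideanSpace ℝ (Fin k)), dist g g' < δ ∧
      ∀ t y, SmallCov {x | g' (t, x) = y} (n - k + 1) ε := by
  classical
  obtain ⟨ρ, hρ, hρd⟩ := Metric.uniformContinuous_iff.1
    (PiLp.uniformContinuous_toLp 2 (fun _ : Fin k => ℝ)) (δ / 2) (by linarith)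
  set η : ℝ := ρ / 4 with hη
  have hη0 : 0 < η := by positivity
  let G : ℕ → (Fin m → unitInterval) × K → ℝ := fun j q => if h : j < k then g q ⟨j, h⟩ else 0
  have hGc : ∀ j, Continuous (G j) := by
    intro j
    by_cases h : j < k
    · simp only [G, h, dif_pos]
      fun_prop
    · simp only [G, h, dif_neg, not_false_iff]
      exact continuous_const
  obtain ⟨ε₁, hε₁, hε₁G⟩ : ∃ ε₁ > 0, ∀ j t x x', dist x x' < ε₁ →
      |G j (t, x) - G j (t, x')| ≤ η := by
    have h1 : Continuous fun q => (g q).ofLp := by fun_prop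
    obtain ⟨ε₁, hε₁, h2⟩ := Metric.uniformContinuous_iff.1
      (CompactSpace.uniformContinuous_of_continuous h1) η hη0
    refine ⟨ε₁, hε₁, fun j t x x' hx => ?_⟩
    by_cases h : j < k
    · simp only [G, h, dif_pos]
      have h3 : dist (t, x) (t, x') < ε₁ := by
        rw [Prod.dist_eq, dist_self]; exact max_lt hε₁ hx
      have h4 := dist_le_pi_dist (g (t, x)).ofLp (g (t, x')).ofLp ⟨j, h⟩
      exact h4.trans (h2 h3).le
    · simp only [G, h, dif_neg, not_false_iff]
      simpa using hη0.le
  set M : ℕ := k * (m + 1) with hM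
  set ε₀ : ℝ := min ε₁ (ε / 3 ^ M) with hε₀
  have hε₀0 : 0 < ε₀ := lt_min hε₁ (by positivity)
  obtain ⟨N, lev, W, hWo, hWε, hWd, hWc⟩ := exists_levels hK ε₀ hε₀0
  -- closed shrinking, restricted to the good levels
  obtain ⟨C, hCc, hCcl, hCW⟩ : ∃ C : Finset (Fin N) → Set K,
      (∀ x, ∃ i, x ∈ C i ∧ lev i ≤ n) ∧ (∀ i, IsClosed (C i)) ∧ ∀ i, C i ⊆ W i := by
    obtain ⟨v, hv1, hv2, hv3⟩ := exists_iUnion_eq_closed_subset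
      (u := fun i => if lev i ≤ n then W i else ∅)
      (by intro i; split_ifs; exacts [hWo i, isOpen_empty])
      (fun x => Set.toFinite _)
      (by
        refine eq_univ_of_forall fun x => ?_
        obtain ⟨i, hi, hl⟩ := hWc x
        exact mem_iUnion.2 ⟨i, by rwa [if_pos hl]⟩)
    refine ⟨v, fun x => ?_, hv2, fun i => ?_⟩
    · obtain ⟨i, hi⟩ := mem_iUnion.1 (hv1.ge (mem_univ x))
      refine ⟨i, hi, ?_⟩
      by_contra hl
      have h1 := hv3 i hi
      rw [if_neg hl] at h1
      exact h1
    · refine (hv3 i).trans ?_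
      split_ifs
      exacts [Subset.rfl, empty_subset _]
  have ha : ∀ i, ∃ a : (Fin m → unitInterval) → ℝ, Continuous a ∧
      ∀ t, ∀ x ∈ W i, |a t - G (lev i) (t, x)| ≤ η := by
    intro i
    by_cases h : (W i).Nonempty
    · obtain ⟨x₀, hx₀⟩ := h
      refine ⟨fun t => G (lev i) (t, x₀), (hGc _).comp (by fun_prop), fun t x hx => ?_⟩
      exact hε₁G _ _ _ _ ((hWε i _ hx₀ _ hx).trans_le (min_le_left _ _))
    · exact ⟨fun _ => 0, continuous_const, fun t x hx => absurd ⟨x, hx⟩ h⟩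
  choose a hac haG using ha
  choose p hpL hpa using fun i => lip_approx (a i) (hac i) η hη0
  obtain ⟨s, hs, hgen⟩ := generic_shift m p hpL η hη0
  let c : Finset (Fin N) → (Fin m → unitInterval) → ℝ := fun i t => p i t + s i
  have hcc : ∀ i, Continuous (c i) := by
    intro i
    obtain ⟨L, hL⟩ := hpL i
    exact hL.continuous.add continuous_const
  have hcG : ∀ i t, ∀ x ∈ W i, |c i t - G (lev i) (t, x)| ≤ 3 * η := by
    intro i t x hx
    have h1 := abs_le.1 (haG i t x hx)
    have h2 := abs_le.1 (hpa i t)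
    have h3 := abs_le.1 (hs i)
    simp only [c]
    rw [abs_le]
    constructor <;> linarith [h1.1, h1.2, h2.1, h2.2, h3.1, h3.2]
  have hu : ∀ i, ∃ u : C(K, ℝ), EqOn u 0 (W i)ᶜ ∧ EqOn u 1 (C i) ∧ ∀ x, u x ∈ Icc (0 : ℝ) 1 :=
    fun i => exists_continuous_zero_one_of_isClosed (hWo i).isClosed_compl (hCcl i)
      (disjoint_compl_left_iff_subset.2 (hCW i))
  choose u hu0 hu1 huI using hu
  let H : ℕ → (Fin m → unitInterval) × K → ℝ := fun j q => G j q +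
    ∑ i ∈ Finset.univ.filter (fun i => lev i = j), u i q.2 * (c i q.1 - G j q)
  have hHc : ∀ j, Continuous (H j) := by
    intro j
    have h1 := hGc j
    refine h1.add (continuous_finsetSum _ fun i _ => ?_)
    have h2 := hcc i
    exact ((u i).continuous.comp continuous_snd).mul ((h2.comp continuous_fst).sub h1)
  have hHi : ∀ i t, ∀ x ∈ W i, H (lev i) (t, x) =
      G (lev i) (t, x) + u i x * (c i t - G (lev i) (t, x)) := by
    intro i t x hx
    simp only [H]
    congr 1
    refine Finset.sum_eq_single_of_mem i (by simp) fun i' hi' hne => ?_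
    have h1 : x ∉ W i' := Set.disjoint_right.1 (hWd i' i (Finset.mem_filter.1 hi').2 hne) hx
    rw [hu0 i' h1]
    simp
  have hHC : ∀ i t, ∀ x ∈ C i, H (lev i) (t, x) = c i t := by
    intro i t x hx
    rw [hHi i t x (hCW i hx), hu1 i hx]
    simp
  have hHG : ∀ j q, |H j q - G j q| ≤ 3 * η := by
    rintro j ⟨t, x⟩
    by_cases h : ∃ i, lev i = j ∧ x ∈ W i
    · obtain ⟨i, rfl, hx⟩ := h
      rw [hHi i t x hx, add_sub_cancel_left, abs_mul, abs_of_nonneg (huI i x).1]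
      refine (mul_le_of_le_one_left (abs_nonneg _) (huI i x).2).trans (hcG i t x hx)
    · have h1 : H j (t, x) = G j (t, x) := by
        simp only [H]
        rw [Finset.sum_eq_zero, add_zero]
        intro i hi
        have h2 : x ∉ W i := fun hx => h ⟨i, (Finset.mem_filter.1 hi).2, hx⟩
        rw [hu0 i h2]
        simp
      rw [h1, sub_self, abs_zero]
      positivity
  refine ⟨⟨fun q => WithLp.toLp 2 fun j : Fin k => H j q, ?_⟩, ?_, ?_⟩
  · exact (PiLp.continuous_toLp 2 (fun _ : Fin k => ℝ)).comp (continuous_pi fun j => hHc j)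
  · refine lt_of_le_of_lt ((ContinuousMap.dist_le (by linarith)).2 fun q => ?_) (half_lt_self hδ)
    refine (hρd (a := (g q).ofLp) (b := fun j : Fin k => H j q) ?_).le
    refine (dist_pi_lt_iff hρ).2 fun j => ?_
    have h1 := hHG j q
    have h2 : G j q = (g q).ofLp j := by simp [G]
    rw [dist_comm, Real.dist_eq, ← h2]
    refine h1.trans_lt ?_
    rw [hη]; linarith
  · intro t y
    have hbase : SmallCov (⋃ i ∈ {i | k ≤ lev i ∧ lev i ≤ n}, W i) (n - k + 1) ε₀ := by
      refine ⟨fun j => {A | ∃ i, lev i = k + j ∧ W i = A}, ?_, ?_, ?_⟩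
      · rintro j _ ⟨i, -, rfl⟩
        exact ⟨hWo i, hWε i⟩
      · rintro j _ ⟨i, hi, rfl⟩ _ ⟨i', hi', rfl⟩ hne
        exact hWd i i' (hi.trans hi'.symm) (by rintro rfl; exact hne rfl)
      · intro x hx
        simp only [mem_iUnion] at hx
        obtain ⟨i, ⟨h1, h2⟩, hx⟩ := hx
        refine mem_iUnion.2 ⟨⟨lev i - k, by omega⟩, W i, ⟨i, ?_, rfl⟩, hx⟩
        show lev i = k + (lev i - k)
        omega
    let S : Finset (Finset (Fin N)) :=
      Finset.univ.filter fun i => ∃ h : lev i < k, c i t = y ⟨lev i, h⟩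
    have hS : S.card ≤ M := by
      have h1 : S ⊆ (Finset.univ : Finset (Fin k)).biUnion
          fun j => Finset.univ.filter fun i => c i t = y j := by
        intro i hi
        obtain ⟨h, hi⟩ := (Finset.mem_filter.1 hi).2
        exact Finset.mem_biUnion.2 ⟨⟨lev i, h⟩, Finset.mem_univ _,
          Finset.mem_filter.2 ⟨Finset.mem_univ _, hi⟩⟩
      refine (Finset.card_le_card h1).trans ?_
      have h2 := Finset.card_biUnion_le_card_mul (Finset.univ : Finset (Fin k))
        (fun j => Finset.univ.filter fun i => c i t = y j) (m + 1)
        fun j _ => hgen t (y j) _ fun i hi => (Finset.mem_filter.1 hi).2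
      simpa using h2
    have h := hbase.insert_finset hε₀0 hWo hWε S
    refine h.mono ?_ ?_
    · intro x hx
      obtain ⟨i, hi, hl⟩ := hCc x
      by_cases hik : lev i < k
      · refine Or.inr (mem_iUnion₂.2 ⟨i, ?_, hCW i hi⟩)
        refine Finset.mem_filter.2 ⟨Finset.mem_univ _, hik, ?_⟩
        rw [← hHC i t x hi, ← (show _ = y from hx)]
        rfl
      · exact Or.inl (mem_iUnion₂.2 ⟨i, ⟨not_lt.1 hik, hl⟩, hCW i hi⟩)
    · have h1 : (3 : ℝ) ^ S.card ≤ 3 ^ M := pow_le_pow_right₀ (by norm_num) hS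
      calc 3 ^ S.card * ε₀ ≤ 3 ^ M * (ε / 3 ^ M) :=
            mul_le_mul h1 (min_le_right _ _) hε₀0.le (by positivity)
        _ = ε := by field_simp

theorem isOpen_forall_compact {A B : Type*} [TopologicalSpace A] [TopologicalSpace B]
    [CompactSpace B] {U : Set (A × B)} (hU : IsOpen U) : IsOpen {a | ∀ b, (a, b) ∈ U} := by
  have h1 := isClosedMap_fst_of_compactSpace (X := A) (Y := B) _ hU.isClosed_compl
  convert h1.isOpen_compl using 1
  ext a
  simp

theorem isOpen_step {K : Type*} [MetricSpace K] [CompactSpace K] (k m r : ℕ) (ε : ℝ) :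
    IsOpen {g : C((Fin m → unitInterval) × K, EuclideanSpace ℝ (Fin k)) |
      ∀ t y, SmallCov {x | g (t, x) = y} r ε} := by
  have h1 : IsOpen {a : (C((Fin m → unitInterval) × K, EuclideanSpace ℝ (Fin k)) ×
      (Fin m → unitInterval) × EuclideanSpace ℝ (Fin k)) | SmallCov {x | a.1 (a.2.1, x) = a.2.2} r ε} := by
    rw [isOpen_iff_mem_nhds]
    rintro ⟨g, t, y⟩ ⟨𝒲, hW1, hW2, hW3⟩
    have hO : IsOpen (⋃ j, ⋃₀ 𝒲 j) :=
      isOpen_iUnion fun j => isOpen_sUnion fun W hW => (hW1 j W hW).1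
    have h2 : IsOpen {q : (C((Fin m → unitInterval) × K, EuclideanSpace ℝ (Fin k)) ×
      (Fin m → unitInterval) × EuclideanSpace ℝ (Fin k)) × K | q.2 ∈ (⋃ j, ⋃₀ 𝒲 j) ∨ q.1.1 (q.1.2.1, q.2) ≠ q.1.2.2} := by
      refine (hO.preimage continuous_snd).union ?_
      exact isOpen_ne_fun (by fun_prop) (by fun_prop)
    have h3 := isOpen_forall_compact h2
    refine Filter.mem_of_superset (h3.mem_nhds ?_) ?_
    · intro x
      by_cases hx : g (t, x) = y
      · exact Or.inl (hW3 hx)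
      · exact Or.inr hx
    · rintro ⟨g', t', y'⟩ hg'
      refine ⟨𝒲, hW1, hW2, fun x hx => ?_⟩
      exact (hg' x).resolve_right fun h => h hx
  let ψ : C((Fin m → unitInterval) × K, EuclideanSpace ℝ (Fin k)) ×
      ((Fin m → unitInterval) × K) → (C((Fin m → unitInterval) × K, EuclideanSpace ℝ (Fin k)) ×
      (Fin m → unitInterval) × EuclideanSpace ℝ (Fin k)) := fun q => (q.1, q.2.1, q.1 q.2)
  have hψ : Continuous ψ := by fun_prop
  have h4 := isOpen_forall_compact (h1.preimage hψ)
  convert h4 using 1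
  ext g
  constructor
  · rintro h ⟨t, x⟩
    exact h t _
  · intro h t y
    by_cases hy : ∃ x, g (t, x) = y
    · obtain ⟨x, rfl⟩ := hy
      exact h (t, x)
    · refine ⟨fun _ => ∅, by simp, by simp, fun x hx => (hy ⟨x, hx⟩).elim⟩

theorem covDim_fiber {X K : Type*} [MetricSpace X] [MetricSpace K] (Z : Set (X × K))
    (hZ : IsCompact Z) (t : X) (ht : ∀ q ∈ Z, q.1 = t) (r : ℕ)
    (h : ∀ N : ℕ, SmallCov {x | (t, x) ∈ Z} (r + 1) (1 / ((N : ℝ) + 1))) : CovDimLENat Z r := by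
  intro 𝒰 _ hUo hUc
  have : CompactSpace Z := isCompact_iff_compactSpace.1 hZ
  obtain ⟨δ, hδ, hb⟩ := lebesgue_number_lemma_of_metric_sUnion (isCompact_univ (X := Z)) hUo hUc.ge
  obtain ⟨N, hN⟩ := exists_nat_one_div_lt hδ
  obtain ⟨𝒲, hW1, hW2, hW3⟩ := h N
  refine ⟨{A | A.Nonempty ∧ ∃ j, ∃ W ∈ 𝒲 j, A = {q : Z | q.1.2 ∈ W}}, ?_, ?_, ?_, ?_⟩
  · rintro _ ⟨-, j, W, hW, rfl⟩
    exact (hW1 j W hW).1.preimage (continuous_snd.comp continuous_subtype_val)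
  · refine eq_univ_of_forall fun q => ?_
    have h1 : q.1.2 ∈ {x | (t, x) ∈ Z} := by
      show (t, q.1.2) ∈ Z
      rw [← ht q.1 q.2]
      exact q.2
    obtain ⟨j, W, hW, hq⟩ := mem_iUnion.1 (hW3 h1)
    exact ⟨{q : Z | q.1.2 ∈ W}, ⟨⟨q, hq⟩, j, W, hW, rfl⟩, hq⟩
  · rintro _ ⟨⟨q, hq⟩, j, W, hW, rfl⟩
    obtain ⟨U, hU, hbU⟩ := hb q (mem_univ _)
    refine ⟨U, hU, fun q' hq' => hbU ?_⟩
    rw [mem_ball, Subtype.dist_eq, Prod.dist_eq, ht _ q.2, ht _ q'.2, dist_self]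
    exact max_lt hδ (((hW1 j W hW).2 _ hq' _ hq).trans hN)
  · intro x
    let φ : Fin (r + 1) → Set Z := fun j => {q : Z | q.1.2 ∈ ⋃₀ {W ∈ 𝒲 j | x.1.2 ∈ W}}
    have hsub : {V ∈ {A : Set Z | A.Nonempty ∧ ∃ j, ∃ W ∈ 𝒲 j, A = {q : Z | q.1.2 ∈ W}} | x ∈ V}
        ⊆ range φ := by
      rintro _ ⟨⟨-, j, W, hW, rfl⟩, hx⟩
      refine ⟨j, ?_⟩
      have h1 : {W' ∈ 𝒲 j | x.1.2 ∈ W'} = {W} := by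
        ext W'
        constructor
        · rintro ⟨hW', hx'⟩
          by_contra hne
          exact Set.disjoint_left.1 (hW2 j hW' hW hne) hx' hx
        · rintro rfl
          exact ⟨hW, hx⟩
      simp only [φ, h1, sUnion_singleton]
    refine ⟨(finite_range φ).subset hsub, (ncard_le_ncard hsub (finite_range φ)).trans ?_⟩
    rw [← image_univ]
    refine (ncard_image_le finite_univ).trans ?_
    rw [ncard_univ, Nat.card_fin]

theorem main_metric {K : Type*} [MetricSpace K] [CompactSpace K]
    (n k : ℕ) (hk : k ≤ n) (hK : CovDimLENat K n) (m : ℕ) :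
    Dense {g : C((Fin m → unitInterval) × K, EuclideanSpace ℝ (Fin k)) |
      ∀ z : (Fin m → unitInterval) × EuclideanSpace ℝ (Fin k),
        CovDimLE ((fun q : (Fin m → unitInterval) × K => (q.1, g q)) ⁻¹' {z})
          ((n : ℤ) - k)} := by
  have hd : Dense (⋂ N : ℕ, {g : C((Fin m → unitInterval) × K, EuclideanSpace ℝ (Fin k)) |
      ∀ t y, SmallCov {x | g (t, x) = y} (n - k + 1) (1 / ((N : ℝ) + 1))}) := by
    refine dense_iInter_of_isOpen (fun N => isOpen_step k m _ _) fun N => ?_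
    refine Metric.dense_iff.2 fun g δ hδ => ?_
    obtain ⟨g', h1, h2⟩ := dense_step hk hK m g (1 / ((N : ℝ) + 1)) δ (by positivity) hδ
    exact ⟨g', by rw [mem_ball, dist_comm]; exact h1, h2⟩
  refine hd.mono fun g hg z => Or.inr ⟨n - k, by omega, ?_⟩
  refine covDim_fiber _ ?_ z.1 ?_ _ ?_
  · have h1 : Continuous fun q : (Fin m → unitInterval) × K => (q.1, g q) := by fun_prop
    exact (isClosed_singleton.preimage h1).isCompact
  · intro q hq
    exact congrArg Prod.fst (show (q.1, g q) = z from hq)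
  · intro N
    refine (mem_iInter.1 hg N z.1 z.2).mono ?_ le_rfl
    intro x hx
    exact congrArg Prod.snd (show (z.1, g (z.1, x)) = z from hx)

/-- (Proposition 4.4) For a compactum `K` with `dim K ≤ n` and
`0 ≤ k ≤ n`, maps `g : 𝕀^m × K → ℝ^k` for which the map `π × g` is `(n-k)`-dimensional
are dense in `C(𝕀^m × K, ℝ^k)` (uniform convergence topology). -/
theorem statement12 {K : Type*} [TopologicalSpace K] [CompactSpace K]
    [TopologicalSpace.MetrizableSpace K]
    (n k : ℕ) (hk : k ≤ n) (hK : CovDimLENat K n) (m : ℕ) (hm : 1 ≤ m) :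
    Dense {g : C((Fin m → unitInterval) × K, EuclideanSpace ℝ (Fin k)) |
      ∀ z : (Fin m → unitInterval) × EuclideanSpace ℝ (Fin k),
        CovDimLE ((fun q : (Fin m → unitInterval) × K => (q.1, g q)) ⁻¹' {z})
          ((n : ℤ) - k)} := by
  let := TopologicalSpace.metrizableSpaceMetric K
  exact main_metric n k hk hK m
end
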